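/- arXiv:2411.09074 — 6 statements merged into one kernel-verified Lean document; each statement's English description precedes it below -/
import Mathlib

section
/- Let D be an sDAG on a taxon set X that has all compatible edges, let D' be the sDAG obtained by applying an NNI to D, and let t' → s' be the central edge of the NNI. If a topology τ' is in D' but not in D, then the central edge t' → s' is an edge of τ', and there exists a topology τ in D such that τ' is an NNI of τ. -/
namespace Phylo

variable {α : Type*} [DecidableEq α]

/-- A node of an sDAG: a finite set of clades (subsets of the taxon set).
A proper subsplit is such a set with exactly two clades; the root node `{X}`
and the leaf nodes `{{x}}` have a single clade. -/
abbrev SNode (α : Type*) := Finset (Finset α)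

/-- `∪(t)`: the union of the clades of a node. -/
def cladeUnion (t : SNode α) : Finset α := t.sup id

/-- A directed graph whose vertices are sDAG nodes, given by plain data. -/
structure Digraph (α : Type*) where
  nodes : Set (SNode α)
  edges : Set (SNode α × SNode α)

/-- A valid node on the taxon set `X`: its clades are nonempty pairwise disjoint
subsets of `X`, and it has either two clades (a proper subsplit) or one clade,
in which case it is the root `{X}` or a leaf `{{x}}`. -/
def IsValidNode (X : Finset α) (t : SNode α) : Prop :=
  (∀ A ∈ t, A ⊆ X) ∧ (∀ A ∈ t, A.Nonempty) ∧
  (∀ A ∈ t, ∀ B ∈ t, A ≠ B → Disjoint A B) ∧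
  (t.card = 1 ∨ t.card = 2) ∧
  (t.card = 1 → t = ({X} : SNode α) ∨ ∃ x, t = ({({x} : Finset α)} : SNode α))

/-- A leaf node `{{x}}`. -/
def IsLeafNode (t : SNode α) : Prop := ∃ x, t = ({({x} : Finset α)} : SNode α)

/-- `s` is a compatible child of `t`: `∪(s)` equals one of the clades of `t`
(the inequality `s ≠ t` only excludes the degenerate self-loops at single-clade
nodes, where a node would trivially partition its own unique clade). -/
def CompatibleChild (t s : SNode α) : Prop := cladeUnion s ∈ t ∧ s ≠ t

/-- `D` is an sDAG on the taxon set `X`. -/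
def IsSDag (X : Finset α) (D : Digraph α) : Prop :=
  ({X} : SNode α) ∈ D.nodes ∧
  (∀ x ∈ X, ({({x} : Finset α)} : SNode α) ∈ D.nodes) ∧
  (∀ t ∈ D.nodes, IsValidNode X t) ∧
  (∀ e ∈ D.edges, e.1 ∈ D.nodes ∧ e.2 ∈ D.nodes ∧ CompatibleChild e.1 e.2)

/-- `τ` is a subgraph of `D`. -/
def Subgraph (τ D : Digraph α) : Prop := τ.nodes ⊆ D.nodes ∧ τ.edges ⊆ D.edges

/-- `τ` is (the sDAG representation of) a rooted bifurcating topology on `X`: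
a tree-structured sDAG in which every non-leaf node has, for each of its clades,
exactly one outgoing edge to a node partitioning that clade, and every non-root
node has exactly one parent edge. -/
def IsTopology (X : Finset α) (τ : Digraph α) : Prop :=
  IsSDag X τ ∧
  (∀ t ∈ τ.nodes, ¬ IsLeafNode t →
    ∀ C ∈ t, ∃! s : SNode α, (t, s) ∈ τ.edges ∧ cladeUnion s = C) ∧
  (∀ s ∈ τ.nodes, s ≠ ({X} : SNode α) → ∃! t : SNode α, (t, s) ∈ τ.edges)

/-- `τ` is a topology in the sDAG `D`. -/
def IsTopologyIn (X : Finset α) (D τ : Digraph α) : Prop :=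
  IsTopology X τ ∧ Subgraph τ D

/-- `D` has edges between all compatible subsplits. -/
def AllCompatibleEdges (D : Digraph α) : Prop :=
  ∀ t ∈ D.nodes, ∀ s ∈ D.nodes, CompatibleChild t s → (t, s) ∈ D.edges

/-- The sDAG obtained from `D` by the NNI at the edge `{A ∪ B, C} → {A, B}`
swapping the clades `B` and `C`.  The new nodes are `t' = {A ∪ C, B}` and
`s' = {A, C}`, and the new edges are the central edge `t' → s'`, the edges
`u → t'` for every edge `u → t` of `D`, and the leafward edges from `s'`
(resp. `t'`) to the children of the old nodes partitioning subsets of `A`, `C`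
(resp. `B`). -/
def nniEnlarge (D : Digraph α) (A B C : Finset α) : Digraph α where
  nodes := D.nodes ∪ {({A ∪ C, B} : SNode α), ({A, C} : SNode α)}
  edges := D.edges ∪ {e : SNode α × SNode α |
      e = (({A ∪ C, B} : SNode α), ({A, C} : SNode α))
    ∨ (∃ u, (u, ({A ∪ B, C} : SNode α)) ∈ D.edges ∧ e = (u, ({A ∪ C, B} : SNode α)))
    ∨ (∃ u, (({A, B} : SNode α), u) ∈ D.edges ∧ cladeUnion u ⊆ A ∧
        e = (({A, C} : SNode α), u))
    ∨ (∃ u, (({A, B} : SNode α), u) ∈ D.edges ∧ cladeUnion u ⊆ B ∧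
        e = (({A ∪ C, B} : SNode α), u))
    ∨ (∃ u, (({A ∪ B, C} : SNode α), u) ∈ D.edges ∧ cladeUnion u ⊆ C ∧
        e = (({A, C} : SNode α), u)) }

/-- The NNI at the edge `{A ∪ B, C} → {A, B}` swapping `B` and `C` is applicable
to `D`: the clades are nonempty and pairwise disjoint and the edge is in `D`. -/
def NNIApplicable (D : Digraph α) (A B C : Finset α) : Prop :=
  A.Nonempty ∧ B.Nonempty ∧ C.Nonempty ∧
  Disjoint A B ∧ Disjoint A C ∧ Disjoint B C ∧
  ((({A ∪ B, C} : SNode α)), (({A, B}) : SNode α)) ∈ D.edges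

/-- The nearest-neighbor interchange on a topology `τ` at the edge
`{A ∪ B, C} → {A, B}`, swapping `B` and `C`: the nodes `{A ∪ B, C}` and `{A, B}`
and their incident edges are removed and replaced by `{A ∪ C, B}` and `{A, C}`,
rewiring the three subtrees on `A`, `B`, `C` accordingly and leaving the rest
of `τ` unchanged. -/
def nniSwapTop (τ : Digraph α) (A B C : Finset α) : Digraph α where
  nodes := (τ.nodes \ {({A ∪ B, C} : SNode α), ({A, B} : SNode α)}) ∪
    {({A ∪ C, B} : SNode α), ({A, C} : SNode α)}
  edges := {e ∈ τ.edges | e.1 ≠ ({A ∪ B, C} : SNode α) ∧ e.1 ≠ ({A, B} : SNode α) ∧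
      e.2 ≠ ({A ∪ B, C} : SNode α) ∧ e.2 ≠ ({A, B} : SNode α)} ∪
    {e : SNode α × SNode α |
      e = (({A ∪ C, B} : SNode α), ({A, C} : SNode α))
    ∨ (∃ u, (u, ({A ∪ B, C} : SNode α)) ∈ τ.edges ∧ e = (u, ({A ∪ C, B} : SNode α)))
    ∨ (∃ u, (({A, B} : SNode α), u) ∈ τ.edges ∧ cladeUnion u ⊆ A ∧
        e = (({A, C} : SNode α), u))
    ∨ (∃ u, (({A, B} : SNode α), u) ∈ τ.edges ∧ cladeUnion u ⊆ B ∧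
        e = (({A ∪ C, B} : SNode α), u))
    ∨ (∃ u, (({A ∪ B, C} : SNode α), u) ∈ τ.edges ∧ cladeUnion u ⊆ C ∧
        e = (({A, C} : SNode α), u)) }

/-- `τ'` is an NNI of the topology `τ`: `τ'` is obtained from `τ` by a
nearest-neighbor interchange at some edge `{A ∪ B, C} → {A, B}` of `τ`
(both NNIs at this edge are captured, by the symmetry of the data in `A`, `B`). -/
def IsNNIOf (τ' τ : Digraph α) : Prop :=
  ∃ A B C : Finset α, A.Nonempty ∧ B.Nonempty ∧ C.Nonempty ∧
    Disjoint A B ∧ Disjoint A C ∧ Disjoint B C ∧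
    (({A ∪ B, C} : SNode α), ({A, B} : SNode α)) ∈ τ.edges ∧
    τ' = nniSwapTop τ A B C

/-- Rooted binary trees with taxa at the leaves. -/
inductive BT (α : Type*) where
  | lf : α → BT α
  | nd : BT α → BT α → BT α

/-- The taxon set of a rooted binary tree. -/
def BT.taxa : BT α → Finset α
  | .lf x => {x}
  | .nd l r => l.taxa ∪ r.taxa

/-- The sDAG node (subsplit) associated to the root of a rooted binary tree. -/
def BT.subsplit : BT α → SNode α
  | .lf x => ({({x} : Finset α)} : SNode α)
  | .nd l r => ({l.taxa, r.taxa} : SNode α)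

/-- The subsplits occurring in a rooted binary tree. -/
def BT.sdagNodes : BT α → Set (SNode α)
  | .lf x => {({({x} : Finset α)} : SNode α)}
  | .nd l r => insert (({l.taxa, r.taxa} : SNode α)) (BT.sdagNodes l ∪ BT.sdagNodes r)

/-- The parent-child subsplit edges of a rooted binary tree. -/
def BT.sdagEdges : BT α → Set (SNode α × SNode α)
  | .lf _ => ∅
  | .nd l r =>
      insert ((({l.taxa, r.taxa} : SNode α), l.subsplit))
        (insert ((({l.taxa, r.taxa} : SNode α), r.subsplit))
          (BT.sdagEdges l ∪ BT.sdagEdges r))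

/-- The sDAG representation of a rooted binary tree, including the root node. -/
def BT.toDigraph (t : BT α) : Digraph α where
  nodes := insert ({t.taxa} : SNode α) t.sdagNodes
  edges := insert (({t.taxa} : SNode α), t.subsplit) t.sdagEdges

/-- The union of two digraphs (the sDAG generated by two sDAGs). -/
def Digraph.union (D E : Digraph α) : Digraph α := ⟨D.nodes ∪ E.nodes, D.edges ∪ E.edges⟩

end Phylo

namespace Phylo

section Helpers

variable {α : Type*} [DecidableEq α]

lemma cu_pair (P Q : Finset α) : cladeUnion ({P, Q} : SNode α) = P ∪ Q := by
  simp [cladeUnion]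

lemma cu_single (P : Finset α) : cladeUnion ({P} : SNode α) = P := by
  simp [cladeUnion]

lemma clade_subset_cu {t : SNode α} {P : Finset α} (h : P ∈ t) : P ⊆ cladeUnion t :=
  Finset.le_sup (f := id) h

lemma cu_nonempty {X : Finset α} {t : SNode α} (h : IsValidNode X t) :
    (cladeUnion t).Nonempty := by
  obtain ⟨_, hne, _, hc, _⟩ := h
  have : t.Nonempty := by
    rw [← Finset.card_pos]; omega
  obtain ⟨P, hP⟩ := this
  exact (hne P hP).mono (clade_subset_cu hP)

lemma cu_subset {X : Finset α} {t : SNode α} (h : IsValidNode X t) :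
    cladeUnion t ⊆ X := by
  unfold cladeUnion
  exact Finset.sup_le (fun P hP => h.1 P hP)

/-- Strict decrease of the union along edges not leaving the root. -/
lemma cu_ssubset {X : Finset α} {τ : Digraph α} (hτ : IsSDag X τ) {t s : SNode α}
    (h : (t, s) ∈ τ.edges) (ht : t ≠ {X}) : cladeUnion s ⊂ cladeUnion t := by
  obtain ⟨h1, h2, h3, h4⟩ := hτ.2.2.2 _ h
  simp only at h1 h2 h3 h4
  obtain ⟨hs, hn, hd, hc, hl⟩ := hτ.2.2.1 _ h1
  have vs := hτ.2.2.1 _ h2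
  rcases hc with hc | hc
  · rcases hl hc with h | ⟨x, rfl⟩
    · exact absurd h ht
    · exfalso
      simp only [Finset.mem_singleton] at h3
      obtain ⟨hs', hn', hd', hc', hl'⟩ := vs
      apply h4
      have key : ∀ P ∈ s, P = {x} := by
        intro P hP
        have := clade_subset_cu hP
        rw [h3, Finset.subset_singleton_iff] at this
        rcases this with h | h
        · exact absurd h (hn' P hP).ne_empty
        · exact h
      have hsn : s.Nonempty := by
        rw [← Finset.card_pos]; omega
      exact (Finset.eq_singleton_iff_nonempty_unique_mem.2 ⟨hsn, key⟩)
  · obtain ⟨P, Q, hPQ, rfl⟩ := Finset.card_eq_two.1 hc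
    rw [cu_pair]
    have hdis := hd P (by simp) Q (by simp) hPQ
    have hP := hn P (by simp)
    have hQ := hn Q (by simp)
    simp only [Finset.mem_insert, Finset.mem_singleton] at h3
    rcases h3 with h3 | h3 <;> rw [h3]
    · refine ⟨Finset.subset_union_left, fun h => ?_⟩
      obtain ⟨q, hq⟩ := hQ
      exact Finset.disjoint_left.1 hdis (h (Finset.mem_union_right _ hq)) hq
    · refine ⟨Finset.subset_union_right, fun h => ?_⟩
      obtain ⟨q, hq⟩ := hP
      exact Finset.disjoint_left.1 hdis hq (h (Finset.mem_union_left _ hq))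

lemma cu_mono {X : Finset α} {τ : Digraph α} (hτ : IsSDag X τ) {t s : SNode α}
    (h : (t, s) ∈ τ.edges) : cladeUnion s ⊆ cladeUnion t :=
  clade_subset_cu (hτ.2.2.2 _ h).2.2.1

lemma not_edge_root {X : Finset α} {τ : Digraph α} (hτ : IsSDag X τ) {t : SNode α}
    (h : (t, ({X} : SNode α)) ∈ τ.edges) : False := by
  by_cases ht : t = {X}
  · exact (hτ.2.2.2 _ h).2.2.2 ht.symm
  · have h1 := cu_ssubset hτ h ht
    rw [cu_single] at h1
    exact h1.2 (cu_subset (hτ.2.2.1 _ (hτ.2.2.2 _ h).1))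

/-- `Dep X τ k n`: `n` is reachable from the root by a path of length `k`. -/
inductive Dep (X : Finset α) (τ : Digraph α) : ℕ → SNode α → Prop
  | root : Dep X τ 0 {X}
  | step {k : ℕ} {t s : SNode α} : Dep X τ k t → (t, s) ∈ τ.edges → Dep X τ (k + 1) s

lemma dep_root {X : Finset α} {τ : Digraph α} (hτ : IsSDag X τ) {k : ℕ}
    (h : Dep X τ k {X}) : k = 0 := by
  cases h with
  | root => rfl
  | step _ h => exact (not_edge_root hτ h).elim

lemma enlarge_edges (D : Digraph α) (A B C : Finset α) (p n : SNode α) :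
    (p, n) ∈ (nniEnlarge D A B C).edges ↔ (p, n) ∈ D.edges ∨
      (p = {A ∪ C, B} ∧ n = {A, C}) ∨ ((p, {A ∪ B, C}) ∈ D.edges ∧ n = {A ∪ C, B}) ∨
      (({A, B}, n) ∈ D.edges ∧ cladeUnion n ⊆ A ∧ p = {A, C}) ∨
      (({A, B}, n) ∈ D.edges ∧ cladeUnion n ⊆ B ∧ p = {A ∪ C, B}) ∨
      (({A ∪ B, C}, n) ∈ D.edges ∧ cladeUnion n ⊆ C ∧ p = {A, C}) := by
  simp only [nniEnlarge, Set.mem_union, Set.mem_ofPred_eq, Prod.mk.injEq]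
  refine or_congr Iff.rfl (or_congr Iff.rfl (or_congr ?_ (or_congr ?_ (or_congr ?_ ?_))))
  · exact ⟨by rintro ⟨u, h, rfl, h'⟩; exact ⟨h, h'⟩, fun h => ⟨p, h.1, rfl, h.2⟩⟩
  all_goals
    exact ⟨by rintro ⟨u, h, h2, h3, rfl⟩; exact ⟨h, h2, h3⟩, fun h => ⟨n, h.1, h.2.1, h.2.2, rfl⟩⟩

lemma swap_edges (D : Digraph α) (A B C : Finset α) (p n : SNode α) :
    (p, n) ∈ (nniSwapTop D A B C).edges ↔ ((p, n) ∈ D.edges ∧ p ≠ {A ∪ B, C} ∧ p ≠ {A, B} ∧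
      n ≠ {A ∪ B, C} ∧ n ≠ {A, B}) ∨
      (p = {A ∪ C, B} ∧ n = {A, C}) ∨ ((p, {A ∪ B, C}) ∈ D.edges ∧ n = {A ∪ C, B}) ∨
      (({A, B}, n) ∈ D.edges ∧ cladeUnion n ⊆ A ∧ p = {A, C}) ∨
      (({A, B}, n) ∈ D.edges ∧ cladeUnion n ⊆ B ∧ p = {A ∪ C, B}) ∨
      (({A ∪ B, C}, n) ∈ D.edges ∧ cladeUnion n ⊆ C ∧ p = {A, C}) := by
  simp only [nniSwapTop, Set.mem_union, Set.mem_ofPred_eq, Prod.mk.injEq]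
  refine or_congr Iff.rfl (or_congr Iff.rfl (or_congr ?_ (or_congr ?_ (or_congr ?_ ?_))))
  · exact ⟨by rintro ⟨u, h, rfl, h'⟩; exact ⟨h, h'⟩, fun h => ⟨p, h.1, rfl, h.2⟩⟩
  all_goals
    exact ⟨by rintro ⟨u, h, h2, h3, rfl⟩; exact ⟨h, h2, h3⟩, fun h => ⟨n, h.1, h.2.1, h.2.2, rfl⟩⟩

lemma exists_dep {X : Finset α} {τ : Digraph α} (hτ : IsTopology X τ) :
    ∀ (d : ℕ) (n : SNode α), n ∈ τ.nodes → X.card - (cladeUnion n).card = d →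
      ∃ k, Dep X τ k n := by
  intro d
  induction d using Nat.strong_induction_on with
  | _ d ih =>
    intro n hn hd
    by_cases hr : n = {X}
    · exact ⟨0, hr ▸ Dep.root⟩
    obtain ⟨p, hp, -⟩ := hτ.2.2 n hn hr
    by_cases hpr : p = {X}
    · subst hpr
      exact ⟨1, Dep.step Dep.root hp⟩
    · have h1 := Finset.card_lt_card (cu_ssubset hτ.1 hp hpr)
      have hpn := (hτ.1.2.2.2 _ hp).1
      have h2 := Finset.card_le_card (cu_subset (hτ.1.2.2.1 _ hpn))
      simp only at h2
      obtain ⟨k, hk⟩ := ih (X.card - (cladeUnion p).card) (by omega) p hpn rfl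
      exact ⟨k + 1, hk.step hp⟩

lemma leaf_no_child {X : Finset α} {τ : Digraph α} (hτ : IsSDag X τ) {t s : SNode α}
    (hX : 2 ≤ X.card)
    (h : (t, s) ∈ τ.edges) : ¬ IsLeafNode t := by
  rintro ⟨x, rfl⟩
  have h0 : ({({x} : Finset α)} : SNode α) ≠ {X} := by
    intro h
    rw [Finset.singleton_inj] at h
    rw [← h] at hX
    simp at hX
  have h1 := cu_ssubset hτ h h0
  have h2 := (hτ.2.2.2 _ h).2.2.1
  simp only [Finset.mem_singleton] at h2
  rw [h2, cu_single] at h1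
  exact h1.2 subset_rfl

lemma dep_unique {X : Finset α} {τ : Digraph α} (hτ : IsTopology X τ) (hX : 2 ≤ X.card)
    (x : α) : ∀ (k : ℕ) (n m : SNode α), Dep X τ k n → Dep X τ k m →
      x ∈ cladeUnion n → x ∈ cladeUnion m → n = m := by
  intro k
  induction k with
  | zero =>
    intro n m hn hm _ _
    cases hn; cases hm; rfl
  | succ k ih =>
    intro n m hn hm xn xm
    cases hn with
    | @step _ p _ hp hpn =>
    cases hm with
    | @step _ q _ hq hqm =>
    obtain rfl := ih p q hp hq (cu_mono hτ.1 hpn xn) (cu_mono hτ.1 hqm xm)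
    have h1 := hτ.1.2.2.2 _ hpn
    have h2 := hτ.1.2.2.2 _ hqm
    have hu : cladeUnion m = cladeUnion n := by
      by_contra hne
      have := (hτ.1.2.2.1 _ h1.1).2.2.1 _ h2.2.2.1 _ h1.2.2.1 hne
      exact Finset.disjoint_left.1 this xm xn
    exact (hτ.2.1 p h1.1 (leaf_no_child hτ.1 hX hpn) _ h1.2.2.1).unique ⟨hpn, rfl⟩ ⟨hqm, hu⟩

lemma dep_chain {X : Finset α} {τ : Digraph α} (hτ : IsTopology X τ) (hX : 2 ≤ X.card)
    (x : α) (k : ℕ) (n : SNode α) (hn : Dep X τ k n) (hnr : n ≠ {X})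
    (xn : x ∈ cladeUnion n) : ∀ (j : ℕ) (m : SNode α), Dep X τ (k + j) m →
      x ∈ cladeUnion m → m = n ∨ cladeUnion m ⊂ cladeUnion n := by
  intro j
  induction j with
  | zero =>
    intro m hm xm
    exact Or.inl (dep_unique hτ hX x k m n hm hn xm xn)
  | succ j ih =>
    intro m hm xm
    cases hm with
    | @step _ q _ hq hqm =>
    have xq := cu_mono hτ.1 hqm xm
    have hqr : q ≠ {X} := by
      rintro rfl
      have hkj : k + j = 0 := by
        exact dep_root hτ.1 hq
      obtain rfl : k = 0 := by omega
      cases hn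
      exact hnr rfl
    have hs := cu_ssubset hτ.1 hqm hqr
    rcases ih q hq xq with rfl | h
    · exact Or.inr hs
    · exact Or.inr (hs.trans h)

/-- Laminarity of a topology. -/
lemma laminar {X : Finset α} {τ : Digraph α} (hτ : IsTopology X τ) (hX : 2 ≤ X.card)
    {n m : SNode α} (hn : n ∈ τ.nodes) (hm : m ∈ τ.nodes) (hnr : n ≠ {X}) (hmr : m ≠ {X})
    {x : α} (xn : x ∈ cladeUnion n) (xm : x ∈ cladeUnion m) :
    m = n ∨ cladeUnion m ⊂ cladeUnion n ∨ cladeUnion n ⊂ cladeUnion m := by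
  obtain ⟨k, hk⟩ := exists_dep hτ _ n hn rfl
  obtain ⟨l, hl⟩ := exists_dep hτ _ m hm rfl
  rcases le_total k l with h | h
  · obtain ⟨j, rfl⟩ := Nat.exists_eq_add_of_le h
    rcases dep_chain hτ hX x k n hk hnr xn j m hl xm with h | h <;> tauto
  · obtain ⟨j, rfl⟩ := Nat.exists_eq_add_of_le h
    rcases dep_chain hτ hX x l m hl hmr xm j n hk xn with h | h
    · exact Or.inl h.symm
    · tauto

/-- The local combinatorial data of an interchange, over abstract node types:
`E'`, `V'` are edges and nodes before, `E` the edges after replacing `t', s'` by `t, s`. -/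
structure Core {N W : Type*} (E' E : N → N → Prop) (V' : N → Prop) (U : N → W)
    (t s t' s' a b c p0 : N) : Prop where
  d1 : t' ≠ s'
  d2 : t ≠ s
  d3 : t ≠ t'
  d4 : s ≠ s'
  d5 : t ≠ s'
  d6 : s ≠ t'
  nab : a ≠ b
  nac : a ≠ c
  nbc : b ≠ c
  as' : a ≠ s'
  bs' : b ≠ s'
  cs' : c ≠ s'
  at' : a ≠ t'
  bt' : b ≠ t'
  ct' : c ≠ t'
  pt0 : p0 ≠ t'
  ps0 : p0 ≠ s'
  tN : ¬ V' t
  sN : ¬ V' s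
  nodes : ∀ p n, E' p n → V' p ∧ V' n
  par : ∀ p q n, E' p n → E' q n → p = q
  es' : ∀ n, E' s' n ↔ n = a ∨ n = c
  et' : ∀ n, E' t' n ↔ n = s' ∨ n = b
  pt' : ∀ p, E' p t' ↔ p = p0
  utt : U t = U t'
  uab : U a ≠ U b
  usc : U s ≠ U c
  hE : ∀ p n, E p n ↔ (E' p n ∧ p ≠ t' ∧ p ≠ s' ∧ n ≠ t' ∧ n ≠ s') ∨
      (p = t ∧ n = s) ∨ (p = p0 ∧ n = t) ∨ (p = s ∧ n = a) ∨ (p = t ∧ n = c) ∨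
      (p = s ∧ n = b)

namespace Core

variable {N W : Type*} {E' E : N → N → Prop} {V' : N → Prop} {U : N → W}
    {t s t' s' a b c p0 : N}

lemma old (h : Core E' E V' U t s t' s' a b c p0) (p n : N) (e : E' p n) :
    p ≠ t ∧ p ≠ s ∧ n ≠ t ∧ n ≠ s := by
  obtain ⟨h1, h2⟩ := h.nodes p n e
  exact ⟨fun q => h.tN (q ▸ h1), fun q => h.sN (q ▸ h1), fun q => h.tN (q ▸ h2),
    fun q => h.sN (q ▸ h2)⟩

lemma oa (h : Core E' E V' U t s t' s' a b c p0) : E' s' a := (h.es' a).2 (Or.inl rfl)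
lemma oc (h : Core E' E V' U t s t' s' a b c p0) : E' s' c := (h.es' c).2 (Or.inr rfl)
lemma ob (h : Core E' E V' U t s t' s' a b c p0) : E' t' b := (h.et' b).2 (Or.inr rfl)
lemma os (h : Core E' E V' U t s t' s' a b c p0) : E' t' s' := (h.et' s').2 (Or.inl rfl)
lemma op (h : Core E' E V' U t s t' s' a b c p0) : E' p0 t' := (h.pt' p0).2 rfl

lemma edges_before (h : Core E' E V' U t s t' s' a b c p0) (p n : N) :
    E' p n ↔ (E' p n ∧ p ≠ t' ∧ p ≠ s' ∧ n ≠ t' ∧ n ≠ s') ∨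
      (p = t' ∧ n = s') ∨ (p = p0 ∧ n = t') ∨ (p = s' ∧ n = a) ∨ (p = s' ∧ n = c) ∨
      (p = t' ∧ n = b) := by
  have h1 := fun q => h.par p t' s' q h.os
  have := h.oa
  have := h.ob
  have := h.oc
  have := h.os
  have := h.op
  have := h.es' n
  have := h.et' n
  have := h.pt' p
  constructor
  · intro e
    grind
  · grind

lemma edges_s (h : Core E' E V' U t s t' s' a b c p0) (n : N) : E s n ↔ n = a ∨ n = b := by
  have := h.old s n
  have := h.old _ _ h.op
  have := h.d2
  rw [h.hE]
  grind

lemma edges_t (h : Core E' E V' U t s t' s' a b c p0) (n : N) : E t n ↔ n = s ∨ n = c := by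
  have := h.old t n
  have := h.old _ _ h.op
  have := h.d2
  rw [h.hE]
  grind

lemma edges_to_t (h : Core E' E V' U t s t' s' a b c p0) (p : N) : E p t ↔ p = p0 := by
  have := h.old p t
  have := h.old _ _ h.oa
  have := h.old _ _ h.ob
  have := h.old _ _ h.oc
  have := h.d2
  rw [h.hE]
  grind

lemma edges_to_s (h : Core E' E V' U t s t' s' a b c p0) (p : N) : E p s ↔ p = t := by
  have := h.old p s
  have := h.old _ _ h.oa
  have := h.old _ _ h.ob
  have := h.old _ _ h.oc
  have := h.d2
  rw [h.hE]
  grind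

lemma edges_old (h : Core E' E V' U t s t' s' a b c p0) (p n : N) (hp : V' p) (h2 : p ≠ t')
    (h3 : p ≠ s') : E p n ↔ (E' p n ∧ n ≠ t') ∨ (p = p0 ∧ n = t) := by
  have := h.tN
  have := h.sN
  have h1 := fun q => h.par p t' s' q h.os
  rw [h.hE]
  grind

lemma edges_to_old (h : Core E' E V' U t s t' s' a b c p0) (p n : N) (hn : V' n) (h2 : n ≠ t')
    (h3 : n ≠ s') : E p n ↔ (E' p n ∧ p ≠ t' ∧ p ≠ s') ∨ (p = s ∧ n = a) ∨ (p = t ∧ n = c) ∨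
      (p = s ∧ n = b) := by
  have := h.tN
  have := h.sN
  rw [h.hE]
  grind

lemma child_old (h : Core E' E V' U t s t' s' a b c p0) (n : N) (hn : V' n) (h2 : n ≠ t')
    (h3 : n ≠ s') (P : W) (hc : ∃! m, E' n m ∧ U m = P) : ∃! m, E n m ∧ U m = P := by
  obtain ⟨m, ⟨hm, um⟩, mu⟩ := hc
  have hp := h.pt' n
  have hu := h.utt
  have ed := fun y => h.edges_old n y hn h2 h3
  by_cases hmt : m = t'
  · subst hmt
    refine ⟨t, ⟨(ed _).2 (Or.inr ⟨hp.1 hm, rfl⟩), hu.trans um⟩, ?_⟩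
    rintro y ⟨hy, uy⟩
    rcases (ed _).1 hy with ⟨q1, q2⟩ | q
    · exact absurd (mu y ⟨q1, uy⟩) q2
    · exact q.2
  · refine ⟨m, ⟨(ed _).2 (Or.inl ⟨hm, hmt⟩), um⟩, ?_⟩
    rintro y ⟨hy, uy⟩
    rcases (ed _).1 hy with ⟨q1, q2⟩ | ⟨q1, q2⟩
    · exact mu y ⟨q1, uy⟩
    · subst q2
      exact absurd (mu t' ⟨hp.2 q1, hu.symm.trans uy⟩).symm hmt

lemma parent_old (h : Core E' E V' U t s t' s' a b c p0) (n : N) (hn : V' n) (h2 : n ≠ t')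
    (h3 : n ≠ s') (hc : ∃! p, E' p n) : ∃! p, E p n := by
  obtain ⟨p, hp, pu⟩ := hc
  have ed := fun y => h.edges_to_old y n hn h2 h3
  have qa := fun q (hq : E' q a) => h.par _ _ _ hq h.oa
  have qb := fun q (hq : E' q b) => h.par _ _ _ hq h.ob
  have qc := fun q (hq : E' q c) => h.par _ _ _ hq h.oc
  have := h.nab
  have := h.nac
  have := h.nbc
  by_cases c1 : n = a
  · refine ⟨s, (ed _).2 (by grind), fun y hy => ?_⟩
    have := (ed _).1 hy
    grind
  by_cases c2 : n = b
  · refine ⟨s, (ed _).2 (by grind), fun y hy => ?_⟩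
    have := (ed _).1 hy
    grind
  by_cases c3 : n = c
  · refine ⟨t, (ed _).2 (by grind), fun y hy => ?_⟩
    have := (ed _).1 hy
    grind
  have hp' := (h.edges_before p n).1 hp
  refine ⟨p, (ed _).2 (by grind), fun y hy => ?_⟩
  have := (ed _).1 hy
  have := pu y
  grind

lemma swap_back (h : Core E' E V' U t s t' s' a b c p0) (p n : N) :
    E' p n ↔ (E p n ∧ p ≠ t ∧ p ≠ s ∧ n ≠ t ∧ n ≠ s) ∨
      (p = t' ∧ n = s') ∨ (p = p0 ∧ n = t') ∨ (p = s' ∧ n = a) ∨ (p = t' ∧ n = b) ∨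
      (p = s' ∧ n = c) := by
  have h1 := h.edges_before p n
  have h2 := h.old p n
  have h3 := h.hE p n
  constructor
  · intro e
    have := h2 e
    rcases h1.1 e with q | q | q | q | q | q
    · exact Or.inl ⟨h3.2 (Or.inl q), h2 e⟩
    all_goals simp only [q, true_and, and_self, true_or, or_true]
  · rintro (⟨q, q1, q2, q3, q4⟩ | q | q | q | q | q)
    · rcases h3.1 q with r | r | r | r | r | r
      · exact r.1
      all_goals tauto
    all_goals exact h1.2 (by simp only [q, true_and, and_self, true_or, or_true])

end Core

end Helpers

/-- If `D` is an sDAG with all compatible edges, `D'` is obtained from `D`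
by an NNI with central edge `t' → s' = ({A ∪ C, B}, {A, C})`, and `τ'` is a topology
in `D'` but not in `D`, then the central edge is an edge of `τ'` and there is a
topology `τ` in `D` such that `τ'` is an NNI of `τ`. -/
theorem statement_0 {α : Type*} [DecidableEq α] (X : Finset α) (D : Digraph α)
    (hD : IsSDag X D) (hall : AllCompatibleEdges D)
    (A B C : Finset α) (hnni : NNIApplicable D A B C)
    (τ' : Digraph α)
    (hτ' : IsTopologyIn X (nniEnlarge D A B C) τ')
    (hnot : ¬ IsTopologyIn X D τ') :
    (({A ∪ C, B} : SNode α), ({A, C} : SNode α)) ∈ τ'.edges ∧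
      ∃ τ : Digraph α, IsTopologyIn X D τ ∧ IsNNIOf τ' τ := by
  obtain ⟨hA, hB, hC, hAB, hAC, hBC, hedge⟩ := hnni
  obtain ⟨hT, hsubN, hsubE⟩ := hτ'
  obtain ⟨htD, hsD, -⟩ := hD.2.2.2 _ hedge
  simp only at htD hsD
  -- elements
  obtain ⟨xa, hxa⟩ := id hA
  obtain ⟨xb, hxb⟩ := id hB
  obtain ⟨xc, hxc⟩ := id hC
  have hab1 := Finset.disjoint_left.1 hAB
  have hac1 := Finset.disjoint_left.1 hAC
  have hbc1 := Finset.disjoint_left.1 hBC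
  have xab : xa ∉ B := hab1 hxa
  have xac : xa ∉ C := hac1 hxa
  have xba : xb ∉ A := fun h => hab1 h hxb
  have xbc : xb ∉ C := hbc1 hxb
  have xca : xc ∉ A := fun h => hac1 h hxc
  have xcb : xc ∉ B := fun h => hbc1 h hxc
  -- inequalities of clades
  have nAB : A ≠ B := by rintro rfl; exact xab hxa
  have nAC : A ≠ C := by rintro rfl; exact xac hxa
  have nBC : B ≠ C := by rintro rfl; exact xbc hxb
  have nACB : A ∪ C ≠ B := by rintro rfl; exact xab (by simp [hxa])
  have nABC : A ∪ B ≠ C := by rintro rfl; exact xac (by simp [hxa])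
  have nACA : A ∪ C ≠ A := by intro h; exact xca (h ▸ (by simp [hxc]))
  have nACC : A ∪ C ≠ C := by intro h; exact xac (h ▸ (by simp [hxa]))
  have nABA : A ∪ B ≠ A := by intro h; exact xba (h ▸ (by simp [hxb]))
  have nABB : A ∪ B ≠ B := by intro h; exact xab (h ▸ (by simp [hxa]))
  have nABAC : A ∪ B ≠ A ∪ C := by
    intro h
    have : xb ∈ A ∪ C := h ▸ (by simp [hxb])
    simp [xba, xbc] at this
  have vt := hD.2.2.1 _ htD
  have vs := hD.2.2.1 _ hsD
  obtain ⟨t, ht⟩ : ∃ t, t = ({A ∪ B, C} : SNode α) := ⟨_, rfl⟩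
  obtain ⟨s, hs⟩ : ∃ s, s = ({A, B} : SNode α) := ⟨_, rfl⟩
  obtain ⟨t', ht'⟩ : ∃ t', t' = ({A ∪ C, B} : SNode α) := ⟨_, rfl⟩
  obtain ⟨s', hs'⟩ : ∃ s', s' = ({A, C} : SNode α) := ⟨_, rfl⟩
  have mt : ∀ P, P ∈ t ↔ P = A ∪ B ∨ P = C := by simp [ht]
  have ms : ∀ P, P ∈ s ↔ P = A ∨ P = B := by simp [hs]
  have mt' : ∀ P, P ∈ t' ↔ P = A ∪ C ∨ P = B := by simp [ht']
  have ms' : ∀ P, P ∈ s' ↔ P = A ∨ P = C := by simp [hs']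
  have ut : cladeUnion t = A ∪ B ∪ C := by rw [ht, cu_pair]
  have us : cladeUnion s = A ∪ B := by rw [hs, cu_pair]
  have ut' : cladeUnion t' = A ∪ B ∪ C := by
    rw [ht', cu_pair]; ext; simp; tauto
  have us' : cladeUnion s' = A ∪ C := by rw [hs', cu_pair]
  have hABCX : A ∪ B ∪ C ⊆ X := by
    have := cu_subset vt
    rwa [cu_pair] at this
  have hX : 2 ≤ X.card := by
    have h2 : ({xa, xb} : Finset α) ⊆ X := by
      intro y hy
      simp at hy
      apply hABCX
      rcases hy with rfl | rfl <;> simp [hxa, hxb]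
    have h3 : ({xa, xb} : Finset α).card = 2 :=
      Finset.card_pair (by rintro rfl; exact xab hxb)
    have := Finset.card_le_card h2
    omega
  have single : ∀ (n : SNode α) (P Q R: Finset α), P ∈ n → Q ∈ n → P ≠ Q → n ≠ {R} := by
    rintro n P Q R hP hQ hne rfl
    simp at hP hQ
    exact hne (hP.trans hQ.symm)
  have rt : ∀ R, t ≠ {R} := fun R => single t (A ∪ B) C R (by simp [mt]) (by simp [mt]) nABC
  have rs : ∀ R, s ≠ {R} := fun R => single s A B R (by simp [ms]) (by simp [ms]) nAB
  have rt' : ∀ R, t' ≠ {R} := fun R => single t' (A ∪ C) B R (by simp [mt']) (by simp [mt']) nACB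
  have rs' : ∀ R, s' ≠ {R} := fun R => single s' A C R (by simp [ms']) (by simp [ms']) nAC
  have lt' : ¬ IsLeafNode t' := by rintro ⟨x, hx⟩; exact rt' _ hx
  have ls' : ¬ IsLeafNode s' := by rintro ⟨x, hx⟩; exact rs' _ hx
  -- distinctness
  have neu : ∀ (n m : SNode α) (P : Finset α), P ∈ n → P ∉ m → n ≠ m := by
    rintro n m P h1 h2 rfl; exact h2 h1
  have nABCAC : A ∪ B ∪ C ≠ A ∪ C := by
    intro h
    have : xb ∈ A ∪ C := h ▸ (by simp [hxb])
    simp [xba, xbc] at this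
  have nABCAB : A ∪ B ∪ C ≠ A ∪ B := by
    intro h
    have : xc ∈ A ∪ B := h ▸ (by simp [hxc])
    simp [xca, xcb] at this
  have d1 : t' ≠ s' := by intro h; apply nABCAC; rw [← ut', h, us']
  have d2 : t ≠ s := by intro h; apply nABCAB; rw [← ut, h, us]
  have d3 : t ≠ t' := neu _ _ (A ∪ B) (by simp [mt]) (by simp [mt', nABAC, nABB])
  have d4 : s ≠ s' := by intro h; apply nABAC; rw [← us, h, us']
  have d5 : t ≠ s' := by intro h; apply nABCAC; rw [← ut, h, us']
  have d6 : s ≠ t' := by intro h; apply nABCAB; rw [← ut', ← h, us]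
  rw [← ht, ← hs] at hedge
  rw [← ht] at htD vt
  rw [← hs] at hsD vs
  have hEN : (nniEnlarge D A B C).nodes = D.nodes ∪ {t', s'} := by
    rw [ht', hs']; rfl
  have hEE : ∀ p n, (p, n) ∈ (nniEnlarge D A B C).edges ↔ (p, n) ∈ D.edges ∨
      (p = t' ∧ n = s') ∨ ((p, t) ∈ D.edges ∧ n = t') ∨
      ((s, n) ∈ D.edges ∧ cladeUnion n ⊆ A ∧ p = s') ∨
      ((s, n) ∈ D.edges ∧ cladeUnion n ⊆ B ∧ p = t') ∨
      ((t, n) ∈ D.edges ∧ cladeUnion n ⊆ C ∧ p = s') := by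
    intro p n
    rw [ht', hs', ht, hs]
    exact enlarge_edges D A B C p n
  have hTe := hT.1.2.2.2
  have compat : ∀ p n, (p, n) ∈ τ'.edges → p ∈ τ'.nodes ∧ n ∈ τ'.nodes ∧
      cladeUnion n ∈ p ∧ n ≠ p := fun p n h => by
    obtain ⟨h1, h2, h3, h4⟩ := hTe _ h
    exact ⟨h1, h2, h3, h4⟩
  have Dn : ∀ p n, (p, n) ∈ D.edges → p ∈ D.nodes ∧ n ∈ D.nodes := fun p n h => by
    obtain ⟨h1, h2, -⟩ := hD.2.2.2 _ h
    exact ⟨h1, h2⟩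
  have nodesD : ∀ n ∈ τ'.nodes, n ≠ t' → n ≠ s' → n ∈ D.nodes := by
    intro n hn h1 h2
    have := hsubN hn
    rw [hEN] at this
    simp [h1, h2] at this
    exact this
  have child := hT.2.1
  have parent := hT.2.2
  have central : (t', s') ∈ τ'.edges := by
    by_cases c1 : t' ∈ τ'.nodes ∧ t' ∉ D.nodes
    · obtain ⟨n, ⟨hn, hn'⟩, -⟩ := child t' c1.1 lt' (A ∪ C) (by simp [mt'])
      have := (hEE _ _).1 (hsubE hn)
      have hnot : ¬ cladeUnion n ⊆ B := by
        rw [hn']; intro h; exact xab (h (by simp [hxa]))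
      grind
    by_cases c2 : s' ∈ τ'.nodes ∧ s' ∉ D.nodes
    · obtain ⟨n, hn, -⟩ := parent s' c2.1 (rs' X)
      have := (hEE _ _).1 (hsubE hn)
      grind
    exfalso
    apply hnot
    have hN : τ'.nodes ⊆ D.nodes := by
      intro n hn
      by_cases h1 : n = t'
      · subst h1; tauto
      by_cases h2 : n = s'
      · subst h2; tauto
      exact nodesD n hn h1 h2
    refine ⟨hT, hN, ?_⟩
    rintro ⟨p, n⟩ h
    obtain ⟨h1, h2, h3⟩ := compat p n h
    exact hall p (hN h1) n (hN h2) h3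
  obtain ⟨nt', ns', -⟩ := compat _ _ central
  have tN : t ∉ τ'.nodes := by
    intro h
    rcases laminar hT hX h nt' (rt X) (rt' X) (x := xa) (by simp [ut, hxa]) (by simp [ut', hxa])
      with h | h | h
    · exact d3 h.symm
    · rw [ut, ut'] at h; exact h.2 subset_rfl
    · rw [ut, ut'] at h; exact h.2 subset_rfl
  have sN : s ∉ τ'.nodes := by
    intro h
    rcases laminar hT hX h ns' (rs X) (rs' X) (x := xa) (by simp [us, hxa]) (by simp [us', hxa])
      with h | h | h
    · exact d4 h.symm
    · rw [us, us'] at h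
      have := h.1 (show xc ∈ A ∪ C by simp [hxc])
      simp [xca, xcb] at this
    · rw [us, us'] at h
      have := h.1 (show xb ∈ A ∪ B by simp [hxb])
      simp [xba, xbc] at this
  obtain ⟨p0, hp0, p0u⟩ := parent t' nt' (rt' X)
  obtain ⟨a, ⟨ha, ua⟩, au⟩ := child s' ns' ls' A (by simp [ms'])
  obtain ⟨c, ⟨hc, uc⟩, cu⟩ := child s' ns' ls' C (by simp [ms'])
  obtain ⟨b, ⟨hb, ub⟩, bu⟩ := child t' nt' lt' B (by simp [mt'])
  have su : ∀ n, (t', n) ∈ τ'.edges → cladeUnion n = A ∪ C → n = s' := fun n h1 h2 =>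
    (child t' nt' lt' (A ∪ C) (by simp [mt'])).unique ⟨h1, h2⟩ ⟨central, us'⟩
  have es' : ∀ n, (s', n) ∈ τ'.edges ↔ n = a ∨ n = c := by
    intro n
    constructor
    · intro h
      rcases (ms' _).1 (compat _ _ h).2.2.1 with h1 | h1
      · exact Or.inl (au n ⟨h, h1⟩)
      · exact Or.inr (cu n ⟨h, h1⟩)
    · rintro (rfl | rfl) <;> assumption
  have et' : ∀ n, (t', n) ∈ τ'.edges ↔ n = s' ∨ n = b := by
    intro n
    constructor
    · intro h
      rcases (mt' _).1 (compat _ _ h).2.2.1 with h1 | h1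
      · exact Or.inl (su n h h1)
      · exact Or.inr (bu n ⟨h, h1⟩)
    · rintro (rfl | rfl) <;> assumption
  have pt' : ∀ p, (p, t') ∈ τ'.edges ↔ p = p0 :=
    fun p => ⟨p0u p, by rintro rfl; exact hp0⟩
  have par : ∀ p q n, (p, n) ∈ τ'.edges → (q, n) ∈ τ'.edges → p = q := by
    intro p q n h1 h2
    have hr : n ≠ {X} := by
      rintro rfl; exact not_edge_root hT.1 h1
    exact (parent n (compat _ _ h1).2.1 hr).unique h1 h2
  have nAsC : ¬ A ⊆ C := fun h => xac (h hxa)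
  have nAsB : ¬ A ⊆ B := fun h => xab (h hxa)
  have nBsC : ¬ B ⊆ C := fun h => xbc (h hxb)
  have nBsA : ¬ B ⊆ A := fun h => xba (h hxb)
  have nCsA : ¬ C ⊆ A := fun h => xca (h hxc)
  have nCsB : ¬ C ⊆ B := fun h => xcb (h hxc)
  have nACsB : ¬ (A ∪ C) ⊆ B := fun h => xab (h (by simp [hxa]))
  have nABsC : ¬ (A ∪ B) ⊆ C := fun h => xac (h (by simp [hxa]))
  have oldE : ∀ p n, (p, n) ∈ τ'.edges → p ≠ t ∧ p ≠ s ∧ n ≠ t ∧ n ≠ s := by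
    intro p n h
    obtain ⟨h1, h2, -⟩ := compat p n h
    exact ⟨fun h => tN (h ▸ h1), fun h => sN (h ▸ h1), fun h => tN (h ▸ h2),
      fun h => sN (h ▸ h2)⟩
  have ea := compat _ _ ha
  have eb := compat _ _ hb
  have ec := compat _ _ hc
  have ep := compat _ _ hp0
  have nab : a ≠ b := by rintro rfl; exact nAB (ua.symm.trans ub)
  have nac : a ≠ c := by rintro rfl; exact nAC (ua.symm.trans uc)
  have nbc : b ≠ c := by rintro rfl; exact nBC (ub.symm.trans uc)
  have bs' : b ≠ s' := by rintro rfl; exact nACB (us'.symm.trans ub)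
  have as' : a ≠ s' := ea.2.2.2
  have cs' : c ≠ s' := ec.2.2.2
  have bt' : b ≠ t' := eb.2.2.2
  have uABC : ∀ P, A ∪ B ∪ C = P → xa ∈ P ∧ xb ∈ P ∧ xc ∈ P := by
    rintro P rfl; simp [hxa, hxb, hxc]
  have at' : a ≠ t' := by
    rintro rfl; exact xba (uABC A (ut'.symm.trans ua)).2.1
  have ct' : c ≠ t' := by
    rintro rfl; exact xac (uABC C (ut'.symm.trans uc)).1
  have pt0 : p0 ≠ t' := ep.2.2.2.symm
  have ps0 : p0 ≠ s' := by
    rintro rfl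
    have := ep.2.2.1
    rw [ut', ms'] at this
    rcases this with h | h
    · exact xba (uABC A h).2.1
    · exact xac (uABC C h).1
  obtain ⟨τ, hτ⟩ : ∃ τ, τ = nniSwapTop τ' A C B := ⟨_, rfl⟩
  have τN : ∀ n, n ∈ τ.nodes ↔ (n ∈ τ'.nodes ∧ n ≠ t' ∧ n ≠ s') ∨ n = t ∨ n = s := by
    intro n
    rw [hτ, ht', hs', ht, hs]
    simp only [nniSwapTop, Set.mem_union, Set.mem_sdiff, Set.mem_insert_iff,
      Set.mem_singleton_iff, not_or]
  have τE : ∀ p n, (p, n) ∈ τ.edges ↔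
      ((p, n) ∈ τ'.edges ∧ p ≠ t' ∧ p ≠ s' ∧ n ≠ t' ∧ n ≠ s') ∨
      (p = t ∧ n = s) ∨ (p = p0 ∧ n = t) ∨ (p = s ∧ n = a) ∨ (p = t ∧ n = c) ∨
      (p = s ∧ n = b) := by
    intro p n
    rw [hτ, swap_edges]
    rw [← ht', ← hs', ← ht, ← hs]
    simp only [es', et', pt']
    have f1 : ((n = a ∨ n = c) ∧ cladeUnion n ⊆ A ∧ p = s) ↔ (p = s ∧ n = a) := by
      constructor
      · rintro ⟨rfl | rfl, h, h'⟩
        · exact ⟨h', rfl⟩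
        · exact absurd (uc ▸ h) nCsA
      · rintro ⟨h', rfl⟩
        exact ⟨Or.inl rfl, ua.subset, h'⟩
    have f2 : ((n = a ∨ n = c) ∧ cladeUnion n ⊆ C ∧ p = t) ↔ (p = t ∧ n = c) := by
      constructor
      · rintro ⟨rfl | rfl, h, h'⟩
        · exact absurd (ua ▸ h) nAsC
        · exact ⟨h', rfl⟩
      · rintro ⟨h', rfl⟩
        exact ⟨Or.inr rfl, uc.subset, h'⟩
    have f3 : ((n = s' ∨ n = b) ∧ cladeUnion n ⊆ B ∧ p = s) ↔ (p = s ∧ n = b) := by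
      constructor
      · rintro ⟨rfl | rfl, h, h'⟩
        · exact absurd (us' ▸ h) nACsB
        · exact ⟨h', rfl⟩
      · rintro ⟨h', rfl⟩
        exact ⟨Or.inr rfl, ub.subset, h'⟩
    rw [f1, f2, f3]
  have core : Core (fun p n => (p, n) ∈ τ'.edges) (fun p n => (p, n) ∈ τ.edges)
      (fun n => n ∈ τ'.nodes) cladeUnion t s t' s' a b c p0 :=
    { d1 := d1, d2 := d2, d3 := d3, d4 := d4, d5 := d5, d6 := d6, nab := nab, nac := nac,
      nbc := nbc, as' := as', bs' := bs', cs' := cs', at' := at', bt' := bt', ct' := ct',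
      pt0 := pt0, ps0 := ps0, tN := tN, sN := sN,
      nodes := fun p n h => ⟨(compat p n h).1, (compat p n h).2.1⟩
      par := par, es' := es', et' := et', pt' := pt', utt := ut.trans ut'.symm,
      uab := by rw [ua, ub]; exact nAB
      usc := by rw [us, uc]; exact nABC
      hE := τE }
  have nτD : τ.nodes ⊆ D.nodes := by
    intro n hn
    rcases (τN n).1 hn with ⟨h1, h2, h3⟩ | rfl | rfl
    · exact nodesD n h1 h2 h3
    · exact htD
    · exact hsD
  have compτ : ∀ p n, (p, n) ∈ τ.edges → p ∈ τ.nodes ∧ n ∈ τ.nodes ∧ CompatibleChild p n := by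
    intro p n h
    have nt : t ∈ τ.nodes := (τN t).2 (Or.inr (Or.inl rfl))
    have ns : s ∈ τ.nodes := (τN s).2 (Or.inr (Or.inr rfl))
    rcases (τE p n).1 h with ⟨q, q1, q2, q3, q4⟩ | ⟨rfl, rfl⟩ | ⟨rfl, rfl⟩ | ⟨rfl, rfl⟩ |
      ⟨rfl, rfl⟩ | ⟨rfl, rfl⟩
    · obtain ⟨h1, h2, h3⟩ := compat p n q
      exact ⟨(τN p).2 (Or.inl ⟨h1, q1, q2⟩), (τN n).2 (Or.inl ⟨h2, q3, q4⟩), h3⟩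
    · exact ⟨nt, ns, by rw [us, mt]; exact Or.inl rfl, d2.symm⟩
    · exact ⟨(τN _).2 (Or.inl ⟨ep.1, pt0, ps0⟩), nt, by rw [ut, ← ut']; exact ep.2.2.1,
        (oldE _ _ hp0).1.symm⟩
    · exact ⟨ns, (τN _).2 (Or.inl ⟨ea.2.1, at', as'⟩), by rw [ua, ms]; exact Or.inl rfl,
        (oldE _ _ ha).2.2.2⟩
    · exact ⟨nt, (τN _).2 (Or.inl ⟨ec.2.1, ct', cs'⟩), by rw [uc, mt]; exact Or.inr rfl,
        (oldE _ _ hc).2.2.1⟩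
    · exact ⟨ns, (τN _).2 (Or.inl ⟨eb.2.1, bt', bs'⟩), by rw [ub, ms]; exact Or.inr rfl,
        (oldE _ _ hb).2.2.2⟩
  have sdag : IsSDag X τ := by
    refine ⟨?_, ?_, fun n hn => hD.2.2.1 n (nτD hn), fun e he => compτ e.1 e.2 he⟩
    · rw [τN]
      exact Or.inl ⟨hT.1.1, (rt' X).symm, (rs' X).symm⟩
    · intro x hx
      rw [τN]
      exact Or.inl ⟨hT.1.2.1 x hx, (rt' _).symm, (rs' _).symm⟩
  have top : IsTopology X τ := by
    refine ⟨sdag, ?_, ?_⟩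
    · intro n hn hl P hP
      rcases (τN n).1 hn with ⟨h1, h2, h3⟩ | h | h
      · exact core.child_old n h1 h2 h3 P (child n h1 hl P hP)
      · rw [h] at hP ⊢
        rcases (mt P).1 hP with h | h
        · refine ⟨s, ⟨(core.edges_t _).2 (Or.inl rfl), us.trans h.symm⟩, ?_⟩
          rintro y ⟨hy, uy⟩
          rcases (core.edges_t _).1 hy with r | r
          · exact r
          · rw [r, uc, h] at uy; exact absurd uy.symm nABC
        · refine ⟨c, ⟨(core.edges_t _).2 (Or.inr rfl), uc.trans h.symm⟩, ?_⟩
          rintro y ⟨hy, uy⟩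
          rcases (core.edges_t _).1 hy with r | r
          · rw [r, us, h] at uy; exact absurd uy nABC
          · exact r
      · rw [h] at hP ⊢
        rcases (ms P).1 hP with h | h
        · refine ⟨a, ⟨(core.edges_s _).2 (Or.inl rfl), ua.trans h.symm⟩, ?_⟩
          rintro y ⟨hy, uy⟩
          rcases (core.edges_s _).1 hy with r | r
          · exact r
          · rw [r, ub, h] at uy; exact absurd uy.symm nAB
        · refine ⟨b, ⟨(core.edges_s _).2 (Or.inr rfl), ub.trans h.symm⟩, ?_⟩
          rintro y ⟨hy, uy⟩
          rcases (core.edges_s _).1 hy with r | r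
          · rw [r, ua, h] at uy; exact absurd uy nAB
          · exact r
    · intro n hn hr
      rcases (τN n).1 hn with ⟨h1, h2, h3⟩ | h | h
      · exact core.parent_old n h1 h2 h3 (parent n h1 hr)
      · rw [h]
        exact ⟨p0, (core.edges_to_t _).2 rfl, fun y hy => (core.edges_to_t _).1 hy⟩
      · rw [h]
        exact ⟨t, (core.edges_to_s _).2 rfl, fun y hy => (core.edges_to_s _).1 hy⟩
  rw [← ht', ← hs']
  refine ⟨central, τ, ⟨top, nτD, ?_⟩, A, B, C, hA, hB, hC, hAB, hAC, hBC, ?_, ?_⟩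
  · rintro ⟨p, n⟩ h
    obtain ⟨h1, h2, h3⟩ := compτ p n h
    exact hall p (nτD h1) n (nτD h2) h3
  · rw [← ht, ← hs]
    exact (core.edges_t _).2 (Or.inl rfl)
  · have e1 : τ'.nodes = (nniSwapTop τ A B C).nodes := by
      ext n
      simp only [nniSwapTop]
      rw [← ht', ← hs', ← ht, ← hs]
      simp only [Set.mem_union, Set.mem_sdiff, Set.mem_insert_iff,
        Set.mem_singleton_iff, not_or, τN]
      constructor
      · intro h
        by_cases h1 : n = t'
        · exact Or.inr (Or.inl h1)
        by_cases h2 : n = s'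
        · exact Or.inr (Or.inr h2)
        exact Or.inl ⟨Or.inl ⟨h, h1, h2⟩, fun q => tN (q ▸ h), fun q => sN (q ▸ h)⟩
      · rintro (⟨h | h | h, h1, h2⟩ | h | h)
        · exact h.1
        · exact absurd h h1
        · exact absurd h h2
        · exact h ▸ nt'
        · exact h ▸ ns'
    have e2 : τ'.edges = (nniSwapTop τ A B C).edges := by
      have fs : ∀ n, (s, n) ∈ τ.edges ↔ n = a ∨ n = b := core.edges_s
      have ft : ∀ n, (t, n) ∈ τ.edges ↔ n = s ∨ n = c := core.edges_t
      have fp : ∀ p, (p, t) ∈ τ.edges ↔ p = p0 := core.edges_to_t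
      ext ⟨p, n⟩
      rw [swap_edges]
      rw [← ht', ← hs', ← ht, ← hs]
      simp only [fs, ft, fp]
      have f1 : ((n = a ∨ n = b) ∧ cladeUnion n ⊆ A ∧ p = s') ↔ (p = s' ∧ n = a) := by
        constructor
        · rintro ⟨rfl | rfl, h, h'⟩
          · exact ⟨h', rfl⟩
          · exact absurd (ub ▸ h) nBsA
        · rintro ⟨h', rfl⟩
          exact ⟨Or.inl rfl, ua.subset, h'⟩
      have f2 : ((n = a ∨ n = b) ∧ cladeUnion n ⊆ B ∧ p = t') ↔ (p = t' ∧ n = b) := by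
        constructor
        · rintro ⟨rfl | rfl, h, h'⟩
          · exact absurd (ua ▸ h) nAsB
          · exact ⟨h', rfl⟩
        · rintro ⟨h', rfl⟩
          exact ⟨Or.inr rfl, ub.subset, h'⟩
      have f3 : ((n = s ∨ n = c) ∧ cladeUnion n ⊆ C ∧ p = s') ↔ (p = s' ∧ n = c) := by
        constructor
        · rintro ⟨rfl | rfl, h, h'⟩
          · exact absurd (us ▸ h) nABsC
          · exact ⟨h', rfl⟩
        · rintro ⟨h', rfl⟩
          exact ⟨Or.inr rfl, uc.subset, h'⟩
      rw [f1, f2, f3]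
      exact core.swap_back p n
    cases τ' with
    | mk N E =>
      simp only at e1 e2
      rw [e1, e2]

end Phylo
end

section
/- Let D be an sDAG on a taxon set X that has all compatible edges, let D' be the sDAG obtained by applying an NNI to D, and let t' → s' be the central edge of the NNI. If a topology τ' is in D' but not in D, then at least one of t' and s' is a node of τ'. -/
namespace Phylo

/-- If `D` has all compatible edges and `τ'` is a topology in the
post-NNI sDAG but not in `D`, then at least one of the new subsplits
`t' = {A ∪ C, B}`, `s' = {A, C}` is a node of `τ'`. -/
theorem statement_5 {α : Type*} [DecidableEq α] (X : Finset α) (D : Digraph α)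
    (hD : IsSDag X D) (hall : AllCompatibleEdges D)
    (A B C : Finset α) (hnni : NNIApplicable D A B C)
    (τ' : Digraph α)
    (hτ' : IsTopologyIn X (nniEnlarge D A B C) τ')
    (hnot : ¬ IsTopologyIn X D τ') :
    ({A ∪ C, B} : SNode α) ∈ τ'.nodes ∨ ({A, C} : SNode α) ∈ τ'.nodes := by
  by_contra hcon
  obtain ⟨ht, hs⟩ := not_or.mp hcon
  obtain ⟨htop, hsub⟩ := hτ'
  have hnodes : τ'.nodes ⊆ D.nodes := by
    intro u hu
    rcases hsub.1 hu with h | h | h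
    · exact h
    · exact absurd (h ▸ hu) ht
    · exact absurd (h ▸ hu) hs
  refine hnot ⟨htop, hnodes, ?_⟩
  rintro ⟨u, v⟩ he
  obtain ⟨h1, h2, h3⟩ := htop.1.2.2.2 _ he
  exact hall u (hnodes h1) v (hnodes h2) h3

end Phylo
end

section
/- Let D be an sDAG on a taxon set X that has all compatible edges, let D' be the sDAG obtained by applying an NNI to D, and let t' → s' be the central edge of the NNI. If a topology τ' is in D' but not in D, and t' is a node of τ', then s' is also a node of τ' and the edge t' → s' is an edge of τ'. -/
namespace Phylo

/-- If `D` has all compatible edges, `τ'` is a topology in the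
post-NNI sDAG but not in `D`, and `t' = {A ∪ C, B}` is a node of `τ'`, then
`s' = {A, C}` is also a node of `τ'` and the central edge `t' → s'` is an
edge of `τ'`. -/
theorem statement_6 {α : Type*} [DecidableEq α] (X : Finset α) (D : Digraph α)
    (hD : IsSDag X D) (hall : AllCompatibleEdges D)
    (A B C : Finset α) (hnni : NNIApplicable D A B C)
    (τ' : Digraph α)
    (hτ' : IsTopologyIn X (nniEnlarge D A B C) τ')
    (hnot : ¬ IsTopologyIn X D τ')
    (ht' : ({A ∪ C, B} : SNode α) ∈ τ'.nodes) :
    ({A, C} : SNode α) ∈ τ'.nodes ∧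
      (({A ∪ C, B} : SNode α), ({A, C} : SNode α)) ∈ τ'.edges := by
  obtain ⟨hA, hB, hC, hAB, hAC, hBC, -⟩ := hnni
  obtain ⟨hT, hsubN, hsubE⟩ := hτ'
  obtain ⟨hS, hchild, hpar⟩ := id hT
  obtain ⟨a, ha⟩ := hA
  obtain ⟨b, hb⟩ := hB
  obtain ⟨c, hc⟩ := hC
  have haB : a ∉ B := fun h => Finset.disjoint_left.mp hAB ha h
  have hcA : c ∉ A := fun h => Finset.disjoint_left.mp hAC h hc
  have haC : a ∉ C := fun h => Finset.disjoint_left.mp hAC ha h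
  -- the two new nodes are distinct
  have hne : ({A, C} : SNode α) ≠ ({A ∪ C, B} : SNode α) := by
    intro h
    have h1 : A ∪ C ∈ ({A, C} : SNode α) := by rw [h]; simp
    rw [Finset.mem_insert, Finset.mem_singleton] at h1
    rcases h1 with h1 | h1
    · exact hcA (h1 ▸ Finset.mem_union_right A hc)
    · exact haC (h1 ▸ Finset.mem_union_left C ha)
  have hsingle : ∀ Y : Finset α, ({A, C} : SNode α) ≠ {Y} := by
    intro Y h
    have h1 : A ∈ ({Y} : SNode α) := by rw [← h]; simp
    have h2 : C ∈ ({Y} : SNode α) := by rw [← h]; simp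
    rw [Finset.mem_singleton] at h1 h2
    exact haC (h2 ▸ h1 ▸ ha)
  have hleaf : ¬ IsLeafNode ({A ∪ C, B} : SNode α) := by
    rintro ⟨x, h⟩
    have h1 : A ∪ C ∈ ({({x} : Finset α)} : SNode α) := by rw [← h]; simp
    have h2 : B ∈ ({({x} : Finset α)} : SNode α) := by rw [← h]; simp
    rw [Finset.mem_singleton] at h1 h2
    exact haB (by rw [h2, ← h1]; exact Finset.mem_union_left C ha)
  suffices hedge : (({A ∪ C, B} : SNode α), ({A, C} : SNode α)) ∈ τ'.edges from
    ⟨(hS.2.2.2 _ hedge).2.1, hedge⟩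
  by_contra hno
  -- `t'` is already a node of `D`
  have ht : ({A ∪ C, B} : SNode α) ∈ D.nodes := by
    obtain ⟨s, ⟨hs, hsu⟩, -⟩ := hchild _ ht' hleaf (A ∪ C) (by simp)
    have hcomp := (hS.2.2.2 _ hs).2.2
    rcases hsubE hs with h | h | ⟨u, -, h⟩ | ⟨u, -, -, h⟩ | ⟨u, -, hu, h⟩ | ⟨u, -, -, h⟩
    · exact (hD.2.2.2 _ h).1
    · exact absurd (h ▸ hs) hno
    · exact absurd (Prod.mk.inj h).2 hcomp.2
    · exact absurd (Prod.mk.inj h).1.symm hne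
    · obtain rfl := (Prod.mk.inj h).2
      rw [hsu] at hu
      exact absurd (hu (Finset.mem_union_left C ha)) haB
    · exact absurd (Prod.mk.inj h).1.symm hne
  -- `s'` is already a node of `D` if it occurs in `τ'`
  have hs' : ({A, C} : SNode α) ∈ τ'.nodes → ({A, C} : SNode α) ∈ D.nodes := by
    intro hm
    obtain ⟨p, hp, -⟩ := hpar _ hm (hsingle X)
    have hcomp := (hS.2.2.2 _ hp).2.2
    rcases hsubE hp with h | h | ⟨u, -, h⟩ | ⟨u, -, -, h⟩ | ⟨u, -, -, h⟩ | ⟨u, -, -, h⟩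
    · exact (hD.2.2.2 _ h).2.1
    · exact absurd (h ▸ hp) hno
    · exact absurd (Prod.mk.inj h).2 hne
    · exact absurd (Prod.mk.inj h).1.symm hcomp.2
    · exact absurd ((Prod.mk.inj h).1 ▸ hp) hno
    · exact absurd (Prod.mk.inj h).1.symm hcomp.2
  have hN : τ'.nodes ⊆ D.nodes := by
    intro n hn
    rcases hsubN hn with h | h | h
    · exact h
    · exact h ▸ ht
    · obtain rfl : n = _ := h
      exact hs' hn
  refine hnot ⟨hT, hN, ?_⟩
  rintro ⟨u, v⟩ he
  obtain ⟨h1, h2, h3⟩ := hS.2.2.2 _ he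
  exact hall _ (hN h1) _ (hN h2) h3

end Phylo
end

section
/- Let D be an sDAG on a taxon set X that has all compatible edges, let D' be the sDAG obtained by applying an NNI to D, and let t' → s' be the central edge of the NNI. If a topology τ' is in D' but not in D, and s' is a node of τ', then t' is also a node of τ' and the edge t' → s' is an edge of τ'. -/
namespace Phylo

theorem mem_sub_cladeUnion {α : Type*} [DecidableEq α] {t : SNode α} {K : Finset α}
    (h : K ∈ t) : K ⊆ cladeUnion t := by
  have := Finset.le_sup (f := id) h
  exact this

theorem cladeUnion_pair {α : Type*} [DecidableEq α] (A B : Finset α) :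
    cladeUnion ({A, B} : SNode α) = A ∪ B := by
  simp [cladeUnion]

theorem ssub_of_card_two {α : Type*} [DecidableEq α] {X : Finset α} {t : SNode α}
    (ht : IsValidNode X t) (h2 : t.card = 2) {K : Finset α} (hK : K ∈ t) :
    K ⊂ cladeUnion t := by
  obtain ⟨-, hne, hdis, -, -⟩ := ht
  obtain ⟨L, hL, hLK⟩ := Finset.exists_mem_ne (by omega : 1 < t.card) K
  refine Finset.ssubset_iff_subset_ne.2 ⟨mem_sub_cladeUnion hK, fun h => ?_⟩
  obtain ⟨x, hx⟩ := hne L hL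
  have h1 : x ∈ K := by rw [h]; exact mem_sub_cladeUnion hL hx
  exact Finset.disjoint_left.1 (hdis L hL K hK hLK) hx h1

theorem edge_ssub {α : Type*} [DecidableEq α] {X : Finset α} {τ : Digraph α}
    (h : IsSDag X τ) {t s : SNode α} (e : (t, s) ∈ τ.edges) (hr : t ≠ {X}) :
    cladeUnion s ⊂ cladeUnion t := by
  obtain ⟨h1, h2, h3⟩ := h.2.2.2 _ e
  have vt := h.2.2.1 _ h1
  have vs := h.2.2.1 _ h2
  simp only at h1 h2 h3 vt vs
  rcases vt.2.2.2.1 with hc | hc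
  · rcases vt.2.2.2.2 hc with h4 | ⟨x, rfl⟩
    · exact absurd h4 hr
    · exfalso
      apply h3.2
      have hu : cladeUnion s = {x} := by simpa using h3.1
      have hall : ∀ K ∈ s, K = {x} := by
        intro K hK
        have := mem_sub_cladeUnion hK
        rw [hu] at this
        exact (Finset.Nonempty.subset_singleton_iff (vs.2.1 K hK)).1 this
      have hsne : s.Nonempty := by
        rw [← Finset.card_pos]
        rcases vs.2.2.2.1 with h | h <;> omega
      exact Finset.eq_singleton_iff_nonempty_unique_mem.2 ⟨hsne, hall⟩
  · exact ssub_of_card_two vt hc h3.1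

theorem cladeUnion_sub {α : Type*} [DecidableEq α] {X : Finset α} {t : SNode α}
    (ht : IsValidNode X t) : cladeUnion t ⊆ X :=
  Finset.sup_le (f := id) ht.1

theorem up_induct {α : Type*} [DecidableEq α] {X : Finset α} {τ : Digraph α}
    (h : IsTopology X τ) (P : SNode α → Prop) (h0 : P {X})
    (hs : ∀ p n, (p, n) ∈ τ.edges → n ≠ {X} → P p → P n) : ∀ n ∈ τ.nodes, P n := by
  have key : ∀ k : ℕ, ∀ n ∈ τ.nodes, X.card - (cladeUnion n).card = k → P n := by
    intro k
    induction k using Nat.strong_induction_on with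
    | _ k ih =>
      intro n hn hk
      by_cases hr : n = {X}
      · rw [hr]; exact h0
      · obtain ⟨p, hp, -⟩ := h.2.2 n hn hr
        refine hs p n hp hr ?_
        by_cases hpr : p = {X}
        · rw [hpr]; exact h0
        · have hlt := Finset.card_lt_card (edge_ssub h.1 hp hpr)
          have hpn := (h.1.2.2.2 _ hp).1
          have hle := Finset.card_le_card (cladeUnion_sub (h.1.2.2.1 _ hpn))
          simp only at hle hpn
          exact ih _ (by omega) p hpn rfl
  intro n hn
  exact key _ n hn rfl

theorem edge_sub {α : Type*} [DecidableEq α] {X : Finset α} {τ : Digraph α}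
    (h : IsSDag X τ) {t s : SNode α} (e : (t, s) ∈ τ.edges) :
    cladeUnion s ⊆ cladeUnion t :=
  mem_sub_cladeUnion (h.2.2.2 _ e).2.2.1

theorem reach_sub {α : Type*} [DecidableEq α] {X : Finset α} {τ : Digraph α}
    (h : IsSDag X τ) {t s : SNode α}
    (e : Relation.ReflTransGen (fun a b => (a, b) ∈ τ.edges) t s) :
    cladeUnion s ⊆ cladeUnion t := by
  induction e with
  | refl => exact subset_rfl
  | tail _ e ih => exact (edge_sub h e).trans ih

theorem chain {α : Type*} [DecidableEq α] {X : Finset α} {τ : Digraph α}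
    (h : IsTopology X τ) {Y : Finset α} (hY : Y.Nonempty) {m : SNode α} (hm : m ∈ τ.nodes)
    (hYm : Y ⊆ cladeUnion m) : ∀ n ∈ τ.nodes, Y ⊆ cladeUnion n →
      Relation.ReflTransGen (fun a b => (a, b) ∈ τ.edges) n m ∨
      Relation.ReflTransGen (fun a b => (a, b) ∈ τ.edges) m n := by
  apply up_induct h
  · intro _
    left
    exact up_induct h (fun m => Relation.ReflTransGen (fun a b => (a, b) ∈ τ.edges) {X} m)
      .refl (fun p n e _ ih => ih.tail e) m hm
  · intro p n e hn ih hYn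
    rcases ih (hYn.trans (edge_sub h.1 e)) with h1 | h1
    · rcases Relation.ReflTransGen.cases_head h1 with h2 | ⟨c, hc, hcm⟩
      · right
        rw [← h2]
        exact .single e
      · left
        have hYc := hYm.trans (reach_sub h.1 hcm)
        obtain ⟨hp, hnn, hpn⟩ := h.1.2.2.2 _ e
        obtain ⟨-, -, hpc⟩ := h.1.2.2.2 _ hc
        simp only at hp hpn hpc hnn
        have heq : cladeUnion c = cladeUnion n := by
          by_contra hne
          obtain ⟨y, hy⟩ := hY
          exact Finset.disjoint_left.1 ((h.1.2.2.1 _ hp).2.2.1 _ hpc.1 _ hpn.1 hne)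
            (hYc hy) (hYn hy)
        have hleaf : ¬ IsLeafNode p := by
          rintro ⟨x, rfl⟩
          by_cases hr : ({({x} : Finset α)} : SNode α) = {X}
          · have hx : X = {x} := by simpa using hr.symm
            have vn := h.1.2.2.1 _ hnn
            apply hn
            have hsne : n.Nonempty := by
              rw [← Finset.card_pos]
              rcases vn.2.2.2.1 with h | h <;> omega
            refine Finset.eq_singleton_iff_nonempty_unique_mem.2 ⟨hsne, fun K hK => ?_⟩
            have := vn.1 K hK
            rw [hx] at this ⊢
            exact (Finset.Nonempty.subset_singleton_iff (vn.2.1 K hK)).1 this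
          · have hlt := edge_ssub h.1 e hr
            have h5 : cladeUnion n = {x} := by simpa using hpn.1
            rw [h5] at hlt
            simp [cladeUnion] at hlt
        have := (h.2.1 p hp hleaf _ hpn.1).unique ⟨hc, heq⟩ ⟨e, rfl⟩
        rw [← this]
        exact hcm
    · right
      exact h1.tail e

theorem reach_eq {α : Type*} [DecidableEq α] {X : Finset α} {τ : Digraph α}
    (h : IsSDag X τ) {n m : SNode α} (h2 : n ≠ {X})
    (hu : cladeUnion n = cladeUnion m)
    (e : Relation.ReflTransGen (fun a b => (a, b) ∈ τ.edges) n m) : n = m := by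
  rcases Relation.ReflTransGen.cases_head e with h3 | ⟨c, hc, hcm⟩
  · exact h3
  · exfalso
    have h4 := edge_ssub h hc h2
    have h5 := reach_sub h hcm
    rw [hu] at h4
    exact h4.2 h5

theorem node_unique {α : Type*} [DecidableEq α] {X : Finset α} {τ : Digraph α}
    (h : IsTopology X τ) {n m : SNode α} (hn : n ∈ τ.nodes) (hm : m ∈ τ.nodes)
    (hnr : n ≠ {X}) (hmr : m ≠ {X}) (hne : (cladeUnion m).Nonempty)
    (hu : cladeUnion n = cladeUnion m) : n = m := by
  rcases chain h hne hm subset_rfl n hn hu.symm.subset with h1 | h1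
  · exact reach_eq h.1 hnr hu h1
  · exact (reach_eq h.1 hmr hu.symm h1).symm

/-- If `D` has all compatible edges, `τ'` is a topology in the
post-NNI sDAG but not in `D`, and `s' = {A, C}` is a node of `τ'`, then
`t' = {A ∪ C, B}` is also a node of `τ'` and the central edge `t' → s'` is an
edge of `τ'`. -/
theorem statement_7 {α : Type*} [DecidableEq α] (X : Finset α) (D : Digraph α)
    (hD : IsSDag X D) (hall : AllCompatibleEdges D)
    (A B C : Finset α) (hnni : NNIApplicable D A B C)
    (τ' : Digraph α)
    (hτ' : IsTopologyIn X (nniEnlarge D A B C) τ')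
    (hnot : ¬ IsTopologyIn X D τ')
    (hs' : ({A, C} : SNode α) ∈ τ'.nodes) :
    ({A ∪ C, B} : SNode α) ∈ τ'.nodes ∧
      (({A ∪ C, B} : SNode α), ({A, C} : SNode α)) ∈ τ'.edges := by
  obtain ⟨hA, hB, hC, hAB, hAC, hBC, hedge⟩ := hnni
  obtain ⟨htop, hsubn, hsube⟩ := hτ'
  have hACne : A ≠ C := by
    rintro rfl
    exact hA.ne_empty (disjoint_self.1 hAC)
  have hsr : ({A, C} : SNode α) ≠ {X} := by
    intro h
    have := congrArg Finset.card h
    rw [Finset.card_pair hACne] at this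
    simp at this
  by_cases ht : ({A ∪ C, B} : SNode α) ∈ τ'.nodes
  · refine ⟨ht, ?_⟩
    have hleaf : ¬ IsLeafNode ({A ∪ C, B} : SNode α) := by
      rintro ⟨x, hx⟩
      have h1 : A ∪ C = {x} := by
        have : A ∪ C ∈ ({A ∪ C, B} : SNode α) := by simp
        rw [hx] at this
        simpa using this
      obtain ⟨a, ha⟩ := hA
      obtain ⟨c, hc⟩ := hC
      have h2 : a = x := by
        have : a ∈ A ∪ C := Finset.mem_union_left _ ha
        rw [h1] at this
        simpa using this
      have h3 : c = x := by
        have : c ∈ A ∪ C := Finset.mem_union_right _ hc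
        rw [h1] at this
        simpa using this
      subst h2
      subst h3
      exact Finset.disjoint_left.1 hAC ha hc
    obtain ⟨w, ⟨hw, hwu⟩, -⟩ := htop.2.1 _ ht hleaf (A ∪ C) (by simp)
    have hwn := (htop.1.2.2.2 _ hw).2.1
    have hwr : w ≠ {X} := by
      rintro rfl
      have hX : X = A ∪ C := by simpa [cladeUnion] using hwu
      have hBX := (htop.1.2.2.1 _ ht).1 B (by simp)
      obtain ⟨b, hb⟩ := hB
      have := hBX hb
      rw [hX, Finset.mem_union] at this
      rcases this with h | h
      · exact Finset.disjoint_left.1 hAB h hb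
      · exact Finset.disjoint_left.1 hBC hb h
    have : w = {A, C} := by
      apply node_unique htop hwn hs' hwr hsr
      · rw [cladeUnion_pair]; exact hA.mono Finset.subset_union_left
      · rw [cladeUnion_pair, hwu]
    rw [← this]
    exact hw
  · exfalso
    obtain ⟨p, hp, -⟩ := htop.2.2 _ hs' hsr
    obtain ⟨hpn, -, hpc⟩ := htop.1.2.2.2 _ hp
    have hpt : p ≠ {A ∪ C, B} := by
      rintro rfl
      exact ht hpn
    have hsD : ({A, C} : SNode α) ∈ D.nodes := by
      rcases hsube hp with h | h | ⟨u, -, h⟩ | ⟨u, -, -, h⟩ | ⟨u, -, -, h⟩ | ⟨u, -, -, h⟩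
      · exact (hD.2.2.2 _ h).2.1
      · exact absurd (Prod.ext_iff.1 h).1 hpt
      · have h6 : ({A, C} : SNode α) = {A ∪ C, B} := (Prod.ext_iff.1 h).2
        rw [h6] at hs'
        exact absurd hs' ht
      · exact absurd (Prod.ext_iff.1 h).1.symm hpc.2
      · exact absurd (Prod.ext_iff.1 h).1 hpt
      · exact absurd (Prod.ext_iff.1 h).1.symm hpc.2
    have hnodes : τ'.nodes ⊆ D.nodes := by
      intro n hn
      rcases hsubn hn with h | h | h
      · exact h
      · exact absurd (h ▸ hn) ht
      · rw [h]; exact hsD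
    refine hnot ⟨htop, hnodes, ?_⟩
    rintro ⟨a, b⟩ e
    obtain ⟨h1, h2, h3⟩ := htop.1.2.2.2 _ e
    exact hall _ (hnodes h1) _ (hnodes h2) h3

end Phylo
end

section
/- Let D₀ be the sDAG generated by (i.e., the union of the sDAG representations of) the three rooted topologies on taxa {0,1,...,10}: τ₁ = (0,(((((1,(2,3)),(4,5)),(6,(7,8))),9),10)), τ₂ = (0,(((1,((2,6),((3,7),8))),(4,5)),(9,10))), and τ₃ = (0,((((((((1,2),3)),((6,7),8)),4),5),10),9)). Then the topologies in D₀ are exactly τ₁, τ₂, and τ₃. -/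
namespace Phylo

/-- τ₁ = (0,(((((1,(2,3)),(4,5)),(6,(7,8))),9),10)) -/
def tau1 : BT ℕ :=
  .nd (.lf 0)
    (.nd
      (.nd
        (.nd
          (.nd (.nd (.lf 1) (.nd (.lf 2) (.lf 3))) (.nd (.lf 4) (.lf 5)))
          (.nd (.lf 6) (.nd (.lf 7) (.lf 8))))
        (.lf 9))
      (.lf 10))

/-- τ₂ = (0,(((1,((2,6),((3,7),8))),(4,5)),(9,10))) -/
def tau2 : BT ℕ :=
  .nd (.lf 0)
    (.nd
      (.nd
        (.nd (.lf 1) (.nd (.nd (.lf 2) (.lf 6)) (.nd (.nd (.lf 3) (.lf 7)) (.lf 8))))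
        (.nd (.lf 4) (.lf 5)))
      (.nd (.lf 9) (.lf 10)))

/-- τ₃ = (0,((((((((1,2),3)),((6,7),8)),4),5),10),9)) -/
def tau3 : BT ℕ :=
  .nd (.lf 0)
    (.nd
      (.nd
        (.nd
          (.nd
            (.nd (.nd (.nd (.lf 1) (.lf 2)) (.lf 3)) (.nd (.nd (.lf 6) (.lf 7)) (.lf 8)))
            (.lf 4))
          (.lf 5))
        (.lf 10))
      (.lf 9))

/-- The sDAG generated by τ₁, τ₂ and τ₃. -/
def D0 : Digraph ℕ :=
  Digraph.union (Digraph.union (BT.toDigraph tau1) (BT.toDigraph tau2)) (BT.toDigraph tau3)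

end Phylo


namespace Phylo

/-- List version of `BT.sdagNodes`. -/
def nodesL : BT ℕ → List (SNode ℕ)
  | .lf x => [({({x} : Finset ℕ)} : SNode ℕ)]
  | .nd l r => ({l.taxa, r.taxa} : SNode ℕ) :: (nodesL l ++ nodesL r)

/-- List version of `BT.sdagEdges`. -/
def edgesL : BT ℕ → List (SNode ℕ × SNode ℕ)
  | .lf _ => []
  | .nd l r =>
      (({l.taxa, r.taxa} : SNode ℕ), l.subsplit) ::
        (({l.taxa, r.taxa} : SNode ℕ), r.subsplit) :: (edgesL l ++ edgesL r)

def allNodes (t : BT ℕ) : List (SNode ℕ) := ({t.taxa} : SNode ℕ) :: nodesL t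
def allEdges (t : BT ℕ) : List (SNode ℕ × SNode ℕ) :=
  (({t.taxa} : SNode ℕ), t.subsplit) :: edgesL t

lemma mem_nodesL (t : BT ℕ) (x : SNode ℕ) : x ∈ t.sdagNodes ↔ x ∈ nodesL t := by
  induction t with
  | lf a => simp [BT.sdagNodes, nodesL]
  | nd l r hl hr => simp [BT.sdagNodes, nodesL, hl, hr]

lemma mem_edgesL (t : BT ℕ) (x : SNode ℕ × SNode ℕ) : x ∈ t.sdagEdges ↔ x ∈ edgesL t := by
  induction t with
  | lf a => simp [BT.sdagEdges, edgesL]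
  | nd l r hl hr => simp [BT.sdagEdges, edgesL, hl, hr]

lemma mem_allNodes (t : BT ℕ) (x : SNode ℕ) : x ∈ t.toDigraph.nodes ↔ x ∈ allNodes t := by
  simp [BT.toDigraph, allNodes, mem_nodesL]

lemma mem_allEdges (t : BT ℕ) (x : SNode ℕ × SNode ℕ) :
    x ∈ t.toDigraph.edges ↔ x ∈ allEdges t := by
  simp [BT.toDigraph, allEdges, mem_edgesL]

/-- Edges of `D0` as a list. -/
def E0 : List (SNode ℕ × SNode ℕ) := allEdges tau1 ++ allEdges tau2 ++ allEdges tau3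

lemma mem_E0 (x : SNode ℕ × SNode ℕ) : x ∈ D0.edges ↔ x ∈ E0 := by
  simp only [D0, Digraph.union, Set.mem_union, mem_allEdges, E0, List.mem_append]

/-- Decidable validity check for a node. -/
def okNode (t : SNode ℕ) : Prop :=
  (∀ A ∈ t, A ⊆ Finset.range 11) ∧ (∀ A ∈ t, A ≠ ∅) ∧
  (∀ A ∈ t, ∀ B ∈ t, A ≠ B → Disjoint A B) ∧
  (t.card = 1 ∨ t.card = 2) ∧
  (t.card = 1 → t = ({Finset.range 11} : SNode ℕ) ∨
    ∃ x ∈ List.range 11, t = ({({x} : Finset ℕ)} : SNode ℕ))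

instance (t : SNode ℕ) : Decidable (okNode t) := by unfold okNode; infer_instance

/-- Decidable sufficient condition for being a topology. -/
def okTop (N : List (SNode ℕ)) (E : List (SNode ℕ × SNode ℕ)) : Prop :=
  (({Finset.range 11} : SNode ℕ) ∈ N) ∧
  (∀ x ∈ List.range 11, ({({x} : Finset ℕ)} : SNode ℕ) ∈ N) ∧
  (∀ t ∈ N, okNode t) ∧
  (∀ e ∈ E, e.1 ∈ N ∧ e.2 ∈ N ∧ cladeUnion e.2 ∈ e.1 ∧ e.2 ≠ e.1) ∧
  (∀ t ∈ N, (∃ x ∈ List.range 11, t = ({({x} : Finset ℕ)} : SNode ℕ)) ∨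
    ∀ C ∈ t, ∃ e ∈ E, (e.1 = t ∧ cladeUnion e.2 = C) ∧
      ∀ e' ∈ E, e'.1 = t → cladeUnion e'.2 = C → e'.2 = e.2) ∧
  (∀ s ∈ N, s ≠ ({Finset.range 11} : SNode ℕ) → ∃ e ∈ E, e.2 = s ∧
      ∀ e' ∈ E, e'.2 = s → e'.1 = e.1)

instance (N : List (SNode ℕ)) (E : List (SNode ℕ × SNode ℕ)) : Decidable (okTop N E) := by
  unfold okTop; infer_instance

lemma isTop_of_ok (t : BT ℕ) (h : okTop (allNodes t) (allEdges t)) :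
    IsTopology (Finset.range 11) t.toDigraph := by
  obtain ⟨h1, h2, h3, h4, h5, h6⟩ := h
  refine ⟨⟨(mem_allNodes _ _).2 h1, ?_, ?_, ?_⟩, ?_, ?_⟩
  · intro x hx
    exact (mem_allNodes _ _).2 (h2 x (by simpa using hx))
  · intro s hs
    obtain ⟨a, b, c, d, e⟩ := h3 s ((mem_allNodes _ _).1 hs)
    refine ⟨a, fun A hA => Finset.nonempty_iff_ne_empty.2 (b A hA), c, d, fun hc => ?_⟩
    rcases e hc with e | ⟨x, _, e⟩
    · exact Or.inl e
    · exact Or.inr ⟨x, e⟩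
  · intro e he
    obtain ⟨a, b, c⟩ := h4 e ((mem_allEdges _ _).1 he)
    exact ⟨(mem_allNodes _ _).2 a, (mem_allNodes _ _).2 b, c⟩
  · intro s hs hl C hC
    rcases h5 s ((mem_allNodes _ _).1 hs) with ⟨x, _, hx⟩ | h
    · exact absurd ⟨x, hx⟩ hl
    · obtain ⟨e, he, ⟨rfl, hC'⟩, hu⟩ := h C hC
      refine ⟨e.2, ⟨(mem_allEdges _ _).2 he, hC'⟩, ?_⟩
      rintro y ⟨hy, hyC⟩
      exact hu _ ((mem_allEdges _ _).1 hy) rfl hyC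
  · intro s hs hr
    obtain ⟨e, he, rfl, hu⟩ := h6 s ((mem_allNodes _ _).1 hs) hr
    refine ⟨e.1, (mem_allEdges _ _).2 he, ?_⟩
    intro y hy
    exact hu _ ((mem_allEdges _ _).1 hy) rfl

lemma top1 : IsTopology (Finset.range 11) tau1.toDigraph := isTop_of_ok _ (by decide +kernel)
lemma top2 : IsTopology (Finset.range 11) tau2.toDigraph := isTop_of_ok _ (by decide +kernel)
lemma top3 : IsTopology (Finset.range 11) tau3.toDigraph := isTop_of_ok _ (by decide +kernel)

/-- A rank function increasing along edges. -/
def rk (t : SNode ℕ) : ℕ :=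
  if t = ({Finset.range 11} : SNode ℕ) then 0 else 12 - (cladeUnion t).card

lemma E0_rk : ∀ e ∈ E0, rk e.1 < rk e.2 := by decide +kernel

lemma E0_card : ∀ e ∈ E0, 2 ≤ (cladeUnion e.1).card := by decide +kernel

lemma not_leaf {e : SNode ℕ × SNode ℕ} (he : e ∈ D0.edges) : ¬ IsLeafNode e.1 := by
  rintro ⟨x, hx⟩
  have := E0_card e ((mem_E0 _).1 he)
  rw [hx] at this
  simp [cladeUnion] at this

lemma cladeUnion_subsplit (t : BT ℕ) : cladeUnion t.subsplit = t.taxa := by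
  cases t <;> simp [cladeUnion, BT.subsplit, BT.taxa]

lemma subsplit_mem (t : BT ℕ) : t.subsplit ∈ t.sdagNodes := by
  cases t <;> simp [BT.subsplit, BT.sdagNodes]

/-- An edge all of whose `D0`-alternatives coincide with it is forced. -/
lemma forced_edge {τ : Digraph ℕ} (h : IsTopologyIn (Finset.range 11) D0 τ)
    {t s : SNode ℕ} (hts : (t, s) ∈ D0.edges) (ht : t ∈ τ.nodes) (hc : cladeUnion s ∈ t)
    (hu : ∀ e ∈ E0, e.1 = t → cladeUnion e.2 = cladeUnion s → e.2 = s) :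
    (t, s) ∈ τ.edges := by
  obtain ⟨s', ⟨h1, h2⟩, _⟩ := h.1.2.1 t ht (not_leaf hts) _ hc
  have := hu (t, s') ((mem_E0 _).1 (h.2.2 h1)) rfl h2
  simp only at this
  rwa [← this]

lemma forced_tree {τ : Digraph ℕ} (h : IsTopologyIn (Finset.range 11) D0 τ) (t : BT ℕ)
    (ht : t.subsplit ∈ τ.nodes) (hD : t.sdagEdges ⊆ D0.edges)
    (hu : ∀ e' ∈ edgesL t, ∀ e ∈ E0, e.1 = e'.1 → cladeUnion e.2 = cladeUnion e'.2 → e.2 = e'.2) :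
    t.sdagNodes ⊆ τ.nodes ∧ t.sdagEdges ⊆ τ.edges := by
  induction t with
  | lf x => simpa [BT.sdagNodes, BT.sdagEdges, BT.subsplit] using ht
  | nd l r hl hr =>
    simp only [edgesL, List.mem_cons, List.mem_append, forall_eq_or_imp] at hu
    obtain ⟨hul, hur, hu⟩ := hu
    simp only [BT.sdagEdges, Set.insert_subset_iff, Set.union_subset_iff] at hD
    obtain ⟨hDl, hDr, hD1, hD2⟩ := hD
    have el := forced_edge h hDl ht (by simp [cladeUnion_subsplit]) hul
    have er := forced_edge h hDr ht (by simp [cladeUnion_subsplit]) hur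
    obtain ⟨l1, l2⟩ := hl (h.1.1.2.2.2 _ el).2.1 hD1 (fun e he => hu e (Or.inl he))
    obtain ⟨r1, r2⟩ := hr (h.1.1.2.2.2 _ er).2.1 hD2 (fun e he => hu e (Or.inr he))
    simp only [BT.sdagEdges, BT.sdagNodes, Set.insert_subset_iff, Set.union_subset_iff]
    exact ⟨⟨ht, l1, r1⟩, el, er, l2, r2⟩

/-- A topology in `D0` whose edges contain those of another topology equals it. -/
lemma eq_of_edges {τ σ : Digraph ℕ} (h : IsTopologyIn (Finset.range 11) D0 τ)
    (hσ : IsTopology (Finset.range 11) σ) (hE : σ.edges ⊆ τ.edges) : τ = σ := by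
  have key : ∀ e ∈ τ.edges, e.1 ∈ σ.nodes → e ∈ σ.edges := by
    rintro ⟨t, s⟩ he ht
    have hnl := not_leaf (h.2.2 he)
    have hc := (h.1.1.2.2.2 _ he)
    obtain ⟨s', ⟨h1, h2⟩, _⟩ := hσ.2.1 t ht hnl _ hc.2.2.1
    have := (h.1.2.1 t hc.1 hnl _ hc.2.2.1).unique ⟨he, rfl⟩ ⟨hE h1, h2⟩
    rwa [this]
  have hn : ∀ n, ∀ s ∈ τ.nodes, rk s = n → s ∈ σ.nodes := by
    intro n
    induction n using Nat.strong_induction_on with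
    | _ n ih =>
      intro s hs hr
      by_cases hX : s = ({Finset.range 11} : SNode ℕ)
      · rw [hX]; exact hσ.1.1
      · obtain ⟨t, hts, _⟩ := h.1.2.2 s hs hX
        have hlt := E0_rk _ ((mem_E0 _).1 (h.2.2 hts))
        have ht := ih (rk t) (hr ▸ hlt) t (h.1.1.2.2.2 _ hts).1 rfl
        exact (hσ.1.2.2.2 _ (key _ hts ht)).2.1
  have hn' : σ.nodes ⊆ τ.nodes := by
    intro s hs
    by_cases hX : s = ({Finset.range 11} : SNode ℕ)
    · rw [hX]; exact h.1.1.1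
    · obtain ⟨t, hts, _⟩ := hσ.2.2 s hs hX
      exact (h.1.1.2.2.2 _ (hE hts)).2.1
  have e1 : τ.nodes = σ.nodes := Set.Subset.antisymm (fun s hs => hn _ s hs rfl) hn'
  have e2 : τ.edges = σ.edges := Set.Subset.antisymm
    (fun e he => key e he (hn _ _ (h.1.1.2.2.2 _ he).1 rfl)) hE
  cases τ; cases σ; simp_all

/-- The subtree on the taxa `1, …, 10`. -/
def sub : BT ℕ → BT ℕ
  | .lf x => .lf x
  | .nd _ r => r

/-- The top subsplit, common to all three trees. -/
def top0 : SNode ℕ := {{0}, (sub tau1).taxa}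

lemma finish {τ : Digraph ℕ} (h : IsTopologyIn (Finset.range 11) D0 τ) (t : BT ℕ)
    (ht : IsTopology (Finset.range 11) t.toDigraph) (hD : t.toDigraph.edges ⊆ D0.edges)
    (h0 : (top0, (sub t).subsplit) ∈ τ.edges)
    (h1 : (({Finset.range 11} : SNode ℕ), top0) ∈ τ.edges)
    (h2 : (top0, ({{0}} : SNode ℕ)) ∈ τ.edges)
    (hs : ∀ e ∈ allEdges t, e = (({Finset.range 11} : SNode ℕ), top0) ∨
      e = (top0, ({{0}} : SNode ℕ)) ∨ e = (top0, (sub t).subsplit) ∨ e ∈ edgesL (sub t))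
    (hs' : ∀ e ∈ edgesL (sub t), e ∈ allEdges t)
    (hu : ∀ e' ∈ edgesL (sub t), ∀ e ∈ E0,
      e.1 = e'.1 → cladeUnion e.2 = cladeUnion e'.2 → e.2 = e'.2) :
    τ = t.toDigraph := by
  have hf := forced_tree h (sub t) (h.1.1.2.2.2 _ h0).2.1
    (fun e he => hD ((mem_allEdges _ _).2 (hs' e ((mem_edgesL _ _).1 he)))) hu
  refine eq_of_edges h ht fun e he => ?_
  rcases hs e ((mem_allEdges _ _).1 he) with rfl | rfl | rfl | h'
  · exact h1
  · exact h2
  · exact h0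
  · exact hf.2 ((mem_edgesL _ _).2 h')

lemma sg1 : Subgraph tau1.toDigraph D0 :=
  ⟨fun _ h => Or.inl (Or.inl h), fun _ h => Or.inl (Or.inl h)⟩
lemma sg2 : Subgraph tau2.toDigraph D0 :=
  ⟨fun _ h => Or.inl (Or.inr h), fun _ h => Or.inl (Or.inr h)⟩
lemma sg3 : Subgraph tau3.toDigraph D0 := ⟨fun _ h => Or.inr h, fun _ h => Or.inr h⟩

lemma top0_choice : ∀ e ∈ E0, e.1 = top0 → cladeUnion e.2 = (sub tau1).taxa →
    e.2 = (sub tau1).subsplit ∨ e.2 = (sub tau2).subsplit ∨ e.2 = (sub tau3).subsplit := by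
  decide +kernel

lemma forward (τ : Digraph ℕ) (h : IsTopologyIn (Finset.range 11) D0 τ) :
    τ = BT.toDigraph tau1 ∨ τ = BT.toDigraph tau2 ∨ τ = BT.toDigraph tau3 := by
  have h1 : (({Finset.range 11} : SNode ℕ), top0) ∈ τ.edges :=
    forced_edge h ((mem_E0 _).2 (by decide +kernel)) h.1.1.1 (by decide +kernel)
      (by decide +kernel)
  have hT : top0 ∈ τ.nodes := (h.1.1.2.2.2 _ h1).2.1
  have h2D : (top0, ({{0}} : SNode ℕ)) ∈ D0.edges := (mem_E0 _).2 (by decide +kernel)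
  have h2 : (top0, ({{0}} : SNode ℕ)) ∈ τ.edges :=
    forced_edge h h2D hT (by decide +kernel) (by decide +kernel)
  obtain ⟨s, ⟨hs, hc⟩, _⟩ := h.1.2.1 top0 hT (not_leaf h2D) (sub tau1).taxa (by decide +kernel)
  have hch := top0_choice _ ((mem_E0 _).1 (h.2.2 hs)) rfl hc
  simp only at hch
  rcases hch with rfl | rfl | rfl
  · exact Or.inl (finish h _ top1 sg1.2 hs h1 h2 (by decide +kernel) (by decide +kernel)
      (by decide +kernel))
  · exact Or.inr (Or.inl (finish h _ top2 sg2.2 hs h1 h2 (by decide +kernel) (by decide +kernel)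
      (by decide +kernel)))
  · exact Or.inr (Or.inr (finish h _ top3 sg3.2 hs h1 h2 (by decide +kernel) (by decide +kernel)
      (by decide +kernel)))

/-- The topologies in the sDAG `D₀` generated by τ₁, τ₂, τ₃ are
exactly τ₁, τ₂ and τ₃. -/
theorem statement_9 :
    ∀ τ : Digraph ℕ, IsTopologyIn (Finset.range 11) D0 τ ↔
      (τ = BT.toDigraph tau1 ∨ τ = BT.toDigraph tau2 ∨ τ = BT.toDigraph tau3) := by
  intro τ
  refine ⟨forward τ, ?_⟩
  rintro (rfl | rfl | rfl)
  · exact ⟨top1, sg1⟩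
  · exact ⟨top2, sg2⟩
  · exact ⟨top3, sg3⟩

end Phylo
end

section
/- Let D₀ be the sDAG generated by the three rooted topologies on taxa {0,1,...,10}: τ₁ = (0,(((((1,(2,3)),(4,5)),(6,(7,8))),9),10)), τ₂ = (0,(((1,((2,6),((3,7),8))),(4,5)),(9,10))), and τ₃ = (0,((((((((1,2),3)),((6,7),8)),4),5),10),9)). Let D₀' be the sDAG obtained from D₀ by the NNI swapping the clades {4,5} and {6,7,8} at the edge from the subsplit {{1,2,3,4,5},{6,7,8}} to the subsplit {{1,2,3},{4,5}}. Then the topology (0,(((((1,2),3),((6,7),8)),(4,5)),(9,10))) is a topology in D₀' and it is not an NNI of any topology in D₀. -/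
namespace Phylo

/-- The topology (0,(((((1,2),3),((6,7),8)),(4,5)),(9,10))). -/
def tauStar : BT ℕ :=
  .nd (.lf 0)
    (.nd
      (.nd
        (.nd (.nd (.nd (.lf 1) (.lf 2)) (.lf 3)) (.nd (.nd (.lf 6) (.lf 7)) (.lf 8)))
        (.nd (.lf 4) (.lf 5)))
      (.nd (.lf 9) (.lf 10)))

/-- List version of the nodes of a tree. -/
def BT.nodeL : BT ℕ → List (SNode ℕ)
  | .lf x => [({({x} : Finset ℕ)} : SNode ℕ)]
  | .nd l r => (({l.taxa, r.taxa} : SNode ℕ)) :: (BT.nodeL l ++ BT.nodeL r)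

/-- List version of the edges of a tree. -/
def BT.edgeL : BT ℕ → List (SNode ℕ × SNode ℕ)
  | .lf _ => []
  | .nd l r => (({l.taxa, r.taxa} : SNode ℕ), l.subsplit) ::
      (({l.taxa, r.taxa} : SNode ℕ), r.subsplit) :: (BT.edgeL l ++ BT.edgeL r)

theorem BT.mem_nodeL (t : BT ℕ) (n : SNode ℕ) : n ∈ t.sdagNodes ↔ n ∈ t.nodeL := by
  induction t with
  | lf x => simp [BT.sdagNodes, BT.nodeL]
  | nd l r hl hr => simp [BT.sdagNodes, BT.nodeL, hl, hr]

theorem BT.mem_edgeL (t : BT ℕ) (n : SNode ℕ × SNode ℕ) : n ∈ t.sdagEdges ↔ n ∈ t.edgeL := by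
  induction t with
  | lf x => simp [BT.sdagEdges, BT.edgeL]
  | nd l r hl hr => simp [BT.sdagEdges, BT.edgeL, hl, hr]

/-- Nodes of the sDAG representation, as a list. -/
def BT.allN (t : BT ℕ) : List (SNode ℕ) := ({t.taxa} : SNode ℕ) :: t.nodeL

/-- Edges of the sDAG representation, as a list. -/
def BT.allE (t : BT ℕ) : List (SNode ℕ × SNode ℕ) :=
  (({t.taxa} : SNode ℕ), t.subsplit) :: t.edgeL

theorem BT.mem_allN (t : BT ℕ) (n : SNode ℕ) : n ∈ t.toDigraph.nodes ↔ n ∈ t.allN := by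
  simp [BT.toDigraph, BT.allN, BT.mem_nodeL]

theorem BT.mem_allE (t : BT ℕ) (n : SNode ℕ × SNode ℕ) :
    n ∈ t.toDigraph.edges ↔ n ∈ t.allE := by
  simp [BT.toDigraph, BT.allE, BT.mem_edgeL]

/-- Nodes of `D0`, as a list. -/
def D0N : List (SNode ℕ) := tau1.allN ++ tau2.allN ++ tau3.allN

/-- Edges of `D0`, as a list. -/
def D0E : List (SNode ℕ × SNode ℕ) := tau1.allE ++ tau2.allE ++ tau3.allE

theorem mem_D0N (n : SNode ℕ) : n ∈ D0.nodes ↔ n ∈ D0N := by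
  simp [D0, Digraph.union, D0N, BT.mem_allN, or_assoc]

theorem mem_D0E (n : SNode ℕ × SNode ℕ) : n ∈ D0.edges ↔ n ∈ D0E := by
  simp [D0, Digraph.union, D0E, BT.mem_allE, or_assoc]

theorem star_valid : ∀ t ∈ tauStar.allN,
    (∀ A ∈ t, A ⊆ Finset.range 11) ∧ (∀ A ∈ t, A ≠ ∅) ∧
    (∀ A ∈ t, ∀ B ∈ t, A ≠ B → Disjoint A B) ∧
    (t.card = 1 ∨ t.card = 2) ∧
    (t.card = 1 → t = ({Finset.range 11} : SNode ℕ) ∨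
      ∃ x ∈ Finset.range 11, t = ({({x} : Finset ℕ)} : SNode ℕ)) := by
  decide +kernel

theorem star_edges : ∀ e ∈ tauStar.allE, e.1 ∈ tauStar.allN ∧ e.2 ∈ tauStar.allN ∧
    cladeUnion e.2 ∈ e.1 ∧ e.2 ≠ e.1 := by
  decide +kernel

theorem star_children : ∀ t ∈ tauStar.allN,
    (∃ x ∈ Finset.range 11, t = ({({x} : Finset ℕ)} : SNode ℕ)) ∨
    ∀ C ∈ t, ∃ s ∈ tauStar.allN, ((t, s) ∈ tauStar.allE ∧ cladeUnion s = C) ∧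
      ∀ e ∈ tauStar.allE, e.1 = t → cladeUnion e.2 = C → e.2 = s := by
  decide +kernel

theorem star_parents : ∀ s ∈ tauStar.allN, s ≠ ({Finset.range 11} : SNode ℕ) →
    ∃ t ∈ tauStar.allN, (t, s) ∈ tauStar.allE ∧
      ∀ e ∈ tauStar.allE, e.2 = s → e.1 = t := by
  decide +kernel

theorem star_topology : IsTopology (Finset.range 11) (BT.toDigraph tauStar) := by
  refine ⟨⟨?_, ?_, ?_, ?_⟩, ?_, ?_⟩
  · rw [BT.mem_allN]; decide +kernel
  · intro x hx
    rw [BT.mem_allN]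
    have h : ∀ x ∈ Finset.range 11, ({({x} : Finset ℕ)} : SNode ℕ) ∈ tauStar.allN := by
      decide +kernel
    exact h x hx
  · intro t ht
    rw [BT.mem_allN] at ht
    obtain ⟨h1, h2, h3, h4, h5⟩ := star_valid t ht
    refine ⟨h1, fun A hA => Finset.nonempty_iff_ne_empty.2 (h2 A hA), h3, h4, fun h => ?_⟩
    rcases h5 h with h | ⟨x, -, h⟩
    · exact Or.inl h
    · exact Or.inr ⟨x, h⟩
  · intro e he
    rw [BT.mem_allE] at he
    obtain ⟨h1, h2, h3, h4⟩ := star_edges e he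
    exact ⟨(BT.mem_allN _ _).2 h1, (BT.mem_allN _ _).2 h2, h3, h4⟩
  · intro t ht hl C hC
    rw [BT.mem_allN] at ht
    rcases star_children t ht with ⟨x, -, h⟩ | h
    · exact absurd ⟨x, h⟩ hl
    · obtain ⟨s, -, ⟨h1, h2⟩, h3⟩ := h C hC
      refine ⟨s, ⟨(BT.mem_allE _ _).2 h1, h2⟩, ?_⟩
      rintro s' ⟨h4, h5⟩
      exact h3 (t, s') ((BT.mem_allE _ _).1 h4) rfl h5
  · intro s hs hr
    rw [BT.mem_allN] at hs
    obtain ⟨t, -, h1, h2⟩ := star_parents s hs hr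
    refine ⟨t, (BT.mem_allE _ _).2 h1, ?_⟩
    intro t' h
    exact h2 (t', s) ((BT.mem_allE _ _).1 h) rfl

theorem star_nodes_sub : ∀ n ∈ tauStar.allN, n ∈ D0N := by
  decide +kernel

theorem star_edges_sub : ∀ e ∈ tauStar.allE, e ∈ D0E ∨
    e = (({({1, 2, 3} : Finset ℕ) ∪ {6, 7, 8}, {4, 5}} : SNode ℕ),
      ({({1, 2, 3} : Finset ℕ), {6, 7, 8}} : SNode ℕ)) := by
  decide +kernel

set_option synthInstance.maxSize 100000 in
set_option synthInstance.maxHeartbeats 4000000 in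
set_option maxRecDepth 100000 in
set_option maxHeartbeats 4000000 in
/-- Around no edge of `D0` can an NNI be performed with the new upper node and the new central
edge in `tauStar`, attached to a parent of the old upper node in `D0`. -/
theorem no_nni : ∀ e ∈ D0E, ∀ A ∈ e.2, ∀ B ∈ e.2, ∀ C ∈ e.1,
    e.1 = ({A ∪ B, C} : SNode ℕ) → e.2 = ({A, B} : SNode ℕ) →
    Disjoint A B → Disjoint A C → Disjoint B C → A ≠ ∅ → C ≠ ∅ →
    (({{1, 2, 3, 6, 7, 8}, {4, 5}} : SNode ℕ) = {A ∪ C, B} ∨ ({{1, 2, 3, 6, 7, 8}, {4, 5}} : SNode ℕ) = {A, C} ∨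
      ({{1, 2, 3}, {6, 7, 8}} : SNode ℕ) = {A ∪ C, B}) →
    e.1 ≠ ({Finset.range 11} : SNode ℕ) ∧
    ∀ p ∈ D0E, p.2 = e.1 → (({A ∪ C, B} : SNode ℕ), ({A, C} : SNode ℕ)) ∈ tauStar.allE →
      (p.1, ({A ∪ C, B} : SNode ℕ)) ∉ tauStar.allE := by
  decide +kernel

/-- Let `D₀'` be obtained from `D₀` by the NNI swapping `{4,5}` and
`{6,7,8}` at the edge `{{1,2,3,4,5},{6,7,8}} → {{1,2,3},{4,5}}` (so `A = {1,2,3}`,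
`B = {4,5}`, `C = {6,7,8}`).  Then (0,(((((1,2),3),((6,7),8)),(4,5)),(9,10))) is a
topology in `D₀'` and it is not an NNI of any topology in `D₀`. -/
theorem statement_11 :
    IsTopologyIn (Finset.range 11)
        (nniEnlarge D0 ({1, 2, 3} : Finset ℕ) ({4, 5} : Finset ℕ) ({6, 7, 8} : Finset ℕ))
        (BT.toDigraph tauStar) ∧
      ∀ τ : Digraph ℕ, IsTopologyIn (Finset.range 11) D0 τ →
        ¬ IsNNIOf (BT.toDigraph tauStar) τ := by
  refine ⟨⟨star_topology, ?_, ?_⟩, ?_⟩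
  · intro n hn
    exact Or.inl ((mem_D0N _).2 (star_nodes_sub n ((BT.mem_allN _ _).1 hn)))
  · intro e he
    rcases star_edges_sub e ((BT.mem_allE _ _).1 he) with h | h
    · exact Or.inl ((mem_D0E _).2 h)
    · exact Or.inr (Or.inl h)
  · rintro τ ⟨⟨⟨-, -, -, hE⟩, -, hP⟩, -, hsub⟩ ⟨A, B, C, hA, hB, hC, hAB, hAC, hBC, he, hτ⟩
    have hc : (({{1, 2, 3, 6, 7, 8}, {4, 5}} : SNode ℕ) = {A ∪ C, B} ∨ ({{1, 2, 3, 6, 7, 8}, {4, 5}} : SNode ℕ) = {A, C} ∨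
      ({{1, 2, 3}, {6, 7, 8}} : SNode ℕ) = {A ∪ C, B}) := by
      have hmem : (({{1, 2, 3, 6, 7, 8}, {4, 5}} : SNode ℕ), ({{1, 2, 3}, {6, 7, 8}} : SNode ℕ)) ∈
          (BT.toDigraph tauStar).edges := by
        rw [BT.mem_allE]; decide +kernel
      rw [hτ] at hmem
      rcases hmem with h | h | ⟨u, -, h⟩ | ⟨u, -, -, h⟩ | ⟨u, -, -, h⟩ | ⟨u, -, -, h⟩
      · exact absurd ((mem_D0E _).1 (hsub h.1)) (by decide +kernel)
      · exact Or.inl (congrArg Prod.fst h)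
      · exact Or.inr (Or.inr (congrArg Prod.snd h))
      · exact Or.inr (Or.inl (congrArg Prod.fst h))
      · exact Or.inl (congrArg Prod.fst h)
      · exact Or.inr (Or.inl (congrArg Prod.fst h))
    obtain ⟨hr, hno⟩ := no_nni _ ((mem_D0E _).1 (hsub he)) A (by simp) B (by simp) C (by simp)
      rfl rfl hAB hAC hBC hA.ne_empty hC.ne_empty hc
    obtain ⟨p, hp, -⟩ := hP _ (hE _ he).1 hr
    refine hno _ ((mem_D0E _).1 (hsub hp)) rfl ?_ ?_
    · rw [← BT.mem_allE, hτ]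
      exact Or.inr (Or.inl rfl)
    · rw [← BT.mem_allE, hτ]
      exact Or.inr (Or.inr (Or.inl ⟨p, hp, rfl⟩))

end Phylo
end
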